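/- arXiv:1404.7209 — 8 statements merged into one kernel-verified Lean document; each statement's English description precedes it below -/
import Mathlib

section
/- Let X and W be real Hilbert spaces, T a C0-semigroup on X whose adjoint family t ↦ (T t)' is strongly continuous, σ ∈ B(W,X), and C ∈ B(X) self-adjoint. Then for every self-adjoint P0 ∈ B(X) there exists τ > 0 such that there is a unique strongly continuous map P : [0,τ] → Σ(X) with P(0) = P0 satisfying P(t)x = (T t)' P0 (T t x) + ∫₀ᵗ (T(t−s))' [P(s) σ σ' P(s) + C] (T(t−s) x) ds for all t ∈ [0,τ] and x ∈ X; uniqueness holds among all strongly continuous Σ(X)-valued functions on [0,τ] satisfying this integral equation with initial value P0. -/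
open RealInnerProductSpace MeasureTheory

/-- A `C₀`-semigroup of bounded linear operators on `X`: `T 0 = I`,
`T (s+t) = T s ∘ T t` for `s, t ≥ 0`, and `t ↦ T t x` is continuous on `[0,∞)`
for every `x`. -/
def IsC0Semigroup {X : Type*} [NormedAddCommGroup X] [NormedSpace ℝ X]
    (T : ℝ → X →L[ℝ] X) : Prop :=
  T 0 = 1 ∧ (∀ s t : ℝ, 0 ≤ s → 0 ≤ t → T (s + t) = T s ∘L T t) ∧
    ∀ x : X, ContinuousOn (fun t => T t x) (Set.Ici 0)

/-- A mild solution on `[0,τ]` of the operator differential Riccati equation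
`Ṗ = A'P + PA + P σ σ' P + C` associated with the semigroup `T` generated by `A`:
a strongly continuous, self-adjoint-operator-valued map `P` satisfying
`P(t)x = (T t)' P(0) (T t x) + ∫₀ᵗ (T(t−s))' [P(s) σ σ' P(s) + C] (T(t−s) x) ds`. -/
def IsMildRiccatiSolution {X W : Type*}
    [NormedAddCommGroup X] [InnerProductSpace ℝ X] [CompleteSpace X]
    [NormedAddCommGroup W] [InnerProductSpace ℝ W] [CompleteSpace W]
    (T : ℝ → X →L[ℝ] X) (σ : W →L[ℝ] X) (C : X →L[ℝ] X) (τ : ℝ)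
    (P : ℝ → X →L[ℝ] X) : Prop :=
  (∀ t ∈ Set.Icc (0:ℝ) τ, IsSelfAdjoint (P t)) ∧
  (∀ x : X, ContinuousOn (fun t => P t x) (Set.Icc (0:ℝ) τ)) ∧
  ∀ t ∈ Set.Icc (0:ℝ) τ, ∀ x : X,
    P t x = ContinuousLinearMap.adjoint (T t) (P 0 (T t x)) +
      ∫ s in (0:ℝ)..t, ContinuousLinearMap.adjoint (T (t - s))
        ((P s ∘L σ ∘L ContinuousLinearMap.adjoint σ ∘L P s + C) (T (t - s) x))

section StronglyContinuous

variable {X Y : Type*} [NormedAddCommGroup X] [NormedSpace ℝ X]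
  [NormedAddCommGroup Y] [NormedSpace ℝ Y]

/-- A strongly continuous family of operators whose norms are bounded by `M`. -/
structure IsBoundedStrong (F : ℝ → X →L[ℝ] Y) (M : ℝ) : Prop where
  continuous : ∀ x, Continuous fun t => F t x
  norm_le : ∀ t, ‖F t‖ ≤ M

namespace IsBoundedStrong

variable {F : ℝ → X →L[ℝ] Y} {M : ℝ}

theorem nonneg (hF : IsBoundedStrong F M) : 0 ≤ M :=
  (norm_nonneg _).trans (hF.norm_le 0)

theorem mono (hF : IsBoundedStrong F M) {N : ℝ} (h : M ≤ N) : IsBoundedStrong F N :=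
  ⟨hF.continuous, fun t => (hF.norm_le t).trans h⟩

theorem continuous_apply (hF : IsBoundedStrong F M) {Z : Type*} [TopologicalSpace Z]
    {φ : Z → ℝ} {u : Z → X} (hφ : Continuous φ) (hu : Continuous u) :
    Continuous fun z => F (φ z) (u z) := by
  have h : Continuous fun p : ℝ × X => F p.1 p.2 := by
    refine continuous_prod_of_continuous_lipschitzWith' _ ⟨M, hF.nonneg⟩ (fun t => ?_)
      hF.continuous
    exact (F t).lipschitz.weaken (hF.norm_le t)
  exact h.comp (hφ.prodMk hu)

/-- A family that is strongly continuous on `[0,b]` becomes bounded and strongly continuous on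
`ℝ` when its argument is projected to `[0,b]`. -/
theorem exists_projIcc [CompleteSpace X] {b : ℝ} (hb : 0 ≤ b)
    (h : ∀ x, ContinuousOn (fun t => F t x) (Set.Icc 0 b)) :
    ∃ M, IsBoundedStrong (fun t => F (Set.projIcc 0 b hb t)) M := by
  obtain ⟨M, hM⟩ := banach_steinhaus (g := fun t : Set.Icc (0 : ℝ) b => F t) fun x => by
    obtain ⟨K, hK⟩ := isCompact_Icc.exists_bound_of_continuousOn (h x)
    exact ⟨K, fun t => hK t t.2⟩
  refine ⟨M, fun x => ?_, fun t => hM _⟩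
  exact (h x).comp_continuous (continuous_subtype_val.comp continuous_projIcc)
    fun t => (Set.projIcc 0 b hb t).2

end IsBoundedStrong

/-- The Banach space of bounded strongly continuous families of operators, realised as operators
with values in a space of bounded continuous functions. -/
abbrev StrongFamily (X Y : Type*) [NormedAddCommGroup X] [NormedSpace ℝ X]
    [NormedAddCommGroup Y] [NormedSpace ℝ Y] :=
  X →L[ℝ] BoundedContinuousFunction ℝ Y

/-- The family of operators obtained by evaluating an element of `StrongFamily X Y`. -/
noncomputable def evalFamily (P : StrongFamily X Y) (t : ℝ) : X →L[ℝ] Y :=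
  BoundedContinuousFunction.evalCLM ℝ t ∘L P

@[simp]
theorem evalFamily_apply (P : StrongFamily X Y) (t : ℝ) (x : X) :
    evalFamily P t x = P x t := rfl

theorem evalFamily_sub (P Q : StrongFamily X Y) (t : ℝ) :
    evalFamily P t - evalFamily Q t = evalFamily (P - Q) t := by
  ext x
  simp

theorem norm_evalFamily_le (P : StrongFamily X Y) (t : ℝ) :
    ‖evalFamily P t‖ ≤ ‖P‖ :=
  ContinuousLinearMap.opNorm_le_bound _ (norm_nonneg _) fun x =>
    ((P x).norm_coe_le_norm t).trans (P.le_opNorm x)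

theorem isBoundedStrong_evalFamily (P : StrongFamily X Y) :
    IsBoundedStrong (evalFamily P) ‖P‖ :=
  ⟨fun x => (P x).continuous, norm_evalFamily_le P⟩

theorem norm_le_of_norm_apply_apply_le {P : StrongFamily X Y} {K : ℝ}
    (hK : 0 ≤ K) (h : ∀ x t, ‖P x t‖ ≤ K * ‖x‖) : ‖P‖ ≤ K :=
  P.opNorm_le_bound hK fun x =>
    (BoundedContinuousFunction.norm_le (by positivity)).2 (h x)

/-- An iterated Volterra inequality with zero initial value forces a bounded function to be
nonpositive. -/
theorem nonpos_of_volterra_le {d : ℝ → ℝ} {τ D κ : ℝ} (hD : ∀ t ∈ Set.Icc 0 τ, d t ≤ D)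
    (h : ∀ g : ℝ → ℝ, Continuous g → (∀ s ∈ Set.Icc 0 τ, d s ≤ g s) →
      ∀ t ∈ Set.Icc 0 τ, d t ≤ ∫ s in (0 : ℝ)..t, κ * g s) :
    ∀ t ∈ Set.Icc 0 τ, d t ≤ 0 := by
  have key : ∀ n : ℕ, ∀ t ∈ Set.Icc 0 τ, d t ≤ D * ((κ * t) ^ n / n.factorial) := by
    intro n
    induction n with
    | zero => simpa using hD
    | succ n ih =>
      intro t ht
      refine (h _ (by fun_prop) ih t ht).trans_eq ?_
      have : ∀ s : ℝ, κ * (D * ((κ * s) ^ n / n.factorial))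
          = (κ * D * κ ^ n / n.factorial) * s ^ n := fun s => by ring
      simp only [this, intervalIntegral.integral_const_mul, integral_pow]
      rw [Nat.factorial_succ]
      push_cast
      field_simp
      simp
      ring
  intro t ht
  have hlim := (FloorSemiring.tendsto_pow_div_factorial_atTop (κ * t)).const_mul D
  rw [mul_zero] at hlim
  exact ge_of_tendsto' hlim fun n => key n t ht

end StronglyContinuous

section Riccati

open ContinuousLinearMap (adjoint)

variable {X W : Type*}
  [NormedAddCommGroup X] [InnerProductSpace ℝ X] [CompleteSpace X]
  [NormedAddCommGroup W] [InnerProductSpace ℝ W] [CompleteSpace W]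

/-- The right-hand side `P σ σ' P + C` of the Riccati equation. -/
noncomputable def riccatiQuadratic (σ : W →L[ℝ] X) (C P : X →L[ℝ] X) : X →L[ℝ] X :=
  P ∘L σ ∘L adjoint σ ∘L P + C

/-- The integrand `S(t-s)' (P(s) σ σ' P(s) + C) S(t-s)` of the mild Riccati equation. -/
noncomputable def riccatiIntegrand (S : ℝ → X →L[ℝ] X) (σ : W →L[ℝ] X) (C : X →L[ℝ] X)
    (P : ℝ → X →L[ℝ] X) (t s : ℝ) : X →L[ℝ] X :=
  adjoint (S (t - s)) ∘L riccatiQuadratic σ C (P s) ∘L S (t - s)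

theorem norm_adjoint_comp_comp_le {A B : X →L[ℝ] X} {M K : ℝ} (hA : ‖A‖ ≤ M) (hB : ‖B‖ ≤ K) :
    ‖adjoint A ∘L B ∘L A‖ ≤ M ^ 2 * K := by
  have hM : 0 ≤ M := (norm_nonneg _).trans hA
  have hA' : ‖adjoint A‖ ≤ M := by rwa [LinearIsometryEquiv.norm_map]
  calc ‖adjoint A ∘L B ∘L A‖ ≤ ‖adjoint A‖ * (‖B‖ * ‖A‖) :=
        (ContinuousLinearMap.opNorm_comp_le _ _).trans
          (by gcongr; exact ContinuousLinearMap.opNorm_comp_le _ _)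
    _ ≤ M * (K * M) := by gcongr; exact (norm_nonneg _).trans hB
    _ = M ^ 2 * K := by ring

theorem norm_comp_adjoint_comp_le (σ : W →L[ℝ] X) (P Q : X →L[ℝ] X) :
    ‖P ∘L σ ∘L adjoint σ ∘L Q‖ ≤ ‖P‖ * ‖σ‖ ^ 2 * ‖Q‖ := by
  calc ‖P ∘L σ ∘L adjoint σ ∘L Q‖ ≤ ‖P‖ * (‖σ‖ * (‖adjoint σ‖ * ‖Q‖)) := by
        refine (ContinuousLinearMap.opNorm_comp_le _ _).trans ?_
        gcongr
        refine (ContinuousLinearMap.opNorm_comp_le _ _).trans ?_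
        gcongr
        exact ContinuousLinearMap.opNorm_comp_le _ _
    _ = ‖P‖ * ‖σ‖ ^ 2 * ‖Q‖ := by rw [LinearIsometryEquiv.norm_map]; ring

theorem norm_riccatiQuadratic_le (σ : W →L[ℝ] X) (C : X →L[ℝ] X) {P : X →L[ℝ] X} {R : ℝ}
    (hP : ‖P‖ ≤ R) : ‖riccatiQuadratic σ C P‖ ≤ R ^ 2 * ‖σ‖ ^ 2 + ‖C‖ := by
  have hR : 0 ≤ R := (norm_nonneg _).trans hP
  refine (norm_add_le _ _).trans ?_
  gcongr
  calc _ ≤ ‖P‖ * ‖σ‖ ^ 2 * ‖P‖ := norm_comp_adjoint_comp_le σ P P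
    _ ≤ R * ‖σ‖ ^ 2 * R := by gcongr
    _ = R ^ 2 * ‖σ‖ ^ 2 := by ring

theorem norm_riccatiQuadratic_sub_le (σ : W →L[ℝ] X) (C : X →L[ℝ] X) {P Q : X →L[ℝ] X} {R : ℝ}
    (hP : ‖P‖ ≤ R) (hQ : ‖Q‖ ≤ R) :
    ‖riccatiQuadratic σ C P - riccatiQuadratic σ C Q‖ ≤ 2 * R * ‖σ‖ ^ 2 * ‖P - Q‖ := by
  have h : riccatiQuadratic σ C P - riccatiQuadratic σ C Q
      = P ∘L σ ∘L adjoint σ ∘L (P - Q) + (P - Q) ∘L σ ∘L adjoint σ ∘L Q := by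
    ext x
    simp [riccatiQuadratic]
  rw [h]
  calc _ ≤ ‖P‖ * ‖σ‖ ^ 2 * ‖P - Q‖ + ‖P - Q‖ * ‖σ‖ ^ 2 * ‖Q‖ :=
        (norm_add_le _ _).trans
          (add_le_add (norm_comp_adjoint_comp_le _ _ _) (norm_comp_adjoint_comp_le _ _ _))
    _ ≤ R * ‖σ‖ ^ 2 * ‖P - Q‖ + ‖P - Q‖ * ‖σ‖ ^ 2 * R := by gcongr
    _ = 2 * R * ‖σ‖ ^ 2 * ‖P - Q‖ := by ring

theorem isSelfAdjoint_adjoint_comp_comp {B : X →L[ℝ] X} (hB : IsSelfAdjoint B)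
    (A : X →L[ℝ] X) : IsSelfAdjoint (adjoint A ∘L B ∘L A) := by
  simpa using hB.adjoint_conj A

theorem isSelfAdjoint_riccatiQuadratic (σ : W →L[ℝ] X) {C P : X →L[ℝ] X}
    (hC : IsSelfAdjoint C) (hP : IsSelfAdjoint P) : IsSelfAdjoint (riccatiQuadratic σ C P) := by
  refine IsSelfAdjoint.add ?_ hC
  rw [ContinuousLinearMap.isSelfAdjoint_iff'] at hP ⊢
  simp only [ContinuousLinearMap.adjoint_comp, ContinuousLinearMap.adjoint_adjoint, hP]
  rfl

theorem isSelfAdjoint_riccatiIntegrand (S : ℝ → X →L[ℝ] X) (σ : W →L[ℝ] X) {C : X →L[ℝ] X}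
    {P : ℝ → X →L[ℝ] X} (hC : IsSelfAdjoint C) (t s : ℝ) (hP : IsSelfAdjoint (P s)) :
    IsSelfAdjoint (riccatiIntegrand S σ C P t s) :=
  isSelfAdjoint_adjoint_comp_comp (isSelfAdjoint_riccatiQuadratic σ hC hP) _

variable {S : ℝ → X →L[ℝ] X} {M : ℝ} (hS : IsBoundedStrong S M)
  (hS' : IsBoundedStrong (fun t => adjoint (S t)) M) (σ : W →L[ℝ] X) (C : X →L[ℝ] X)
  {P Q : ℝ → X →L[ℝ] X} {R : ℝ} (hP : IsBoundedStrong P R) (hQ : IsBoundedStrong Q R)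

include hS hP in
theorem norm_riccatiIntegrand_le (t s : ℝ) :
    ‖riccatiIntegrand S σ C P t s‖ ≤ M ^ 2 * (R ^ 2 * ‖σ‖ ^ 2 + ‖C‖) :=
  norm_adjoint_comp_comp_le (hS.norm_le _) (norm_riccatiQuadratic_le σ C (hP.norm_le s))

include hS hP hQ in
theorem norm_riccatiIntegrand_sub_le (t s : ℝ) :
    ‖riccatiIntegrand S σ C P t s - riccatiIntegrand S σ C Q t s‖
      ≤ M ^ 2 * (2 * R * ‖σ‖ ^ 2) * ‖P s - Q s‖ := by
  have h : riccatiIntegrand S σ C P t s - riccatiIntegrand S σ C Q t s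
      = adjoint (S (t - s)) ∘L (riccatiQuadratic σ C (P s) - riccatiQuadratic σ C (Q s))
        ∘L S (t - s) := by
    ext x
    simp [riccatiIntegrand]
  rw [h, mul_assoc]
  exact norm_adjoint_comp_comp_le (hS.norm_le _)
    (norm_riccatiQuadratic_sub_le σ C (hP.norm_le s) (hQ.norm_le s))

include hS hS' hP in
theorem continuous_riccatiIntegrand (x : X) :
    Continuous fun p : ℝ × ℝ => riccatiIntegrand S σ C P p.1 p.2 x := by
  have h₁ : Continuous fun p : ℝ × ℝ => p.1 - p.2 := by fun_prop
  have h₂ := hS.continuous_apply h₁ (continuous_const (y := x))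
  have h₃ := hP.continuous_apply (continuous_snd (X := ℝ)) h₂
  have h₄ := hP.continuous_apply (continuous_snd (X := ℝ))
    (σ.continuous.comp ((adjoint σ).continuous.comp h₃))
  exact hS'.continuous_apply h₁ (h₄.add (C.continuous.comp h₂))

include hS hS' hP in
theorem intervalIntegrable_riccatiIntegrand (x : X) (t a b : ℝ) :
    IntervalIntegrable (fun s => riccatiIntegrand S σ C P t s x) volume a b :=
  ((continuous_riccatiIntegrand hS hS' σ C hP x).comp
    (by fun_prop : Continuous fun s : ℝ => (t, s))).intervalIntegrable a b

include hS hS' hP in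
theorem continuous_integral_riccatiIntegrand (x : X) :
    Continuous fun t => ∫ s in (0 : ℝ)..t, riccatiIntegrand S σ C P t s x :=
  intervalIntegral.continuous_parametric_intervalIntegral_of_continuous
    (continuous_riccatiIntegrand hS hS' σ C hP x) continuous_id

include hS hP in
theorem norm_integral_riccatiIntegrand_le (x : X) {t : ℝ} (ht : 0 ≤ t) :
    ‖∫ s in (0 : ℝ)..t, riccatiIntegrand S σ C P t s x‖
      ≤ t * (M ^ 2 * (R ^ 2 * ‖σ‖ ^ 2 + ‖C‖)) * ‖x‖ := by
  refine (intervalIntegral.norm_integral_le_of_norm_le_const fun s _ =>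
    (riccatiIntegrand S σ C P t s).le_of_opNorm_le
      (norm_riccatiIntegrand_le hS σ C hP t s) x).trans_eq ?_
  rw [sub_zero, abs_of_nonneg ht]
  ring

include hS hS' hP hQ in
theorem norm_integral_riccatiIntegrand_sub_le (x : X) {t : ℝ} (ht : 0 ≤ t) {g : ℝ → ℝ}
    (hg : Continuous g) (h : ∀ s ∈ Set.Icc 0 t, ‖P s - Q s‖ ≤ g s) :
    ‖(∫ s in (0 : ℝ)..t, riccatiIntegrand S σ C P t s x)
        - ∫ s in (0 : ℝ)..t, riccatiIntegrand S σ C Q t s x‖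
      ≤ (∫ s in (0 : ℝ)..t, M ^ 2 * (2 * R * ‖σ‖ ^ 2) * g s) * ‖x‖ := by
  rw [← intervalIntegral.integral_sub (intervalIntegrable_riccatiIntegrand hS hS' σ C hP x t 0 t)
    (intervalIntegrable_riccatiIntegrand hS hS' σ C hQ x t 0 t),
    ← intervalIntegral.integral_mul_const]
  refine intervalIntegral.norm_integral_le_of_norm_le ht (.of_forall fun s hs => ?_)
    ((by fun_prop : Continuous _).intervalIntegrable _ _)
  have hR := hP.nonneg
  rw [← sub_apply]
  refine ContinuousLinearMap.le_of_opNorm_le _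
    ((norm_riccatiIntegrand_sub_le hS σ C hP hQ t s).trans ?_) x
  gcongr
  exact h s ⟨hs.1.le, hs.2⟩

include hS' hS in
/-- The right-hand side of the mild Riccati equation on `[0,τ]`, as a self-map of the space of
bounded strongly continuous families. -/
theorem exists_picardMap (P0 : X →L[ℝ] X) {τ : ℝ} (hτ : 0 ≤ τ)
    (P : StrongFamily X X) :
    ∃ L : StrongFamily X X, ∀ x t, L x t =
      (adjoint (S (Set.projIcc 0 τ hτ t)) ∘L P0 ∘L S (Set.projIcc 0 τ hτ t)) x +
        ∫ s in (0 : ℝ)..(Set.projIcc 0 τ hτ t),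
          riccatiIntegrand S σ C (evalFamily P) (Set.projIcc 0 τ hτ t) s x := by
  have hP := isBoundedStrong_evalFamily P
  have hc : Continuous fun t => (Set.projIcc 0 τ hτ t : ℝ) :=
    continuous_subtype_val.comp continuous_projIcc
  have hcont : ∀ x, Continuous fun t =>
      (adjoint (S (Set.projIcc 0 τ hτ t)) ∘L P0 ∘L S (Set.projIcc 0 τ hτ t)) x +
        ∫ s in (0 : ℝ)..(Set.projIcc 0 τ hτ t),
          riccatiIntegrand S σ C (evalFamily P) (Set.projIcc 0 τ hτ t) s x := by
    intro x
    refine Continuous.add ?_ ?_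
    · exact hS'.continuous_apply hc
        (P0.continuous.comp (hS.continuous_apply hc continuous_const))
    · exact (continuous_integral_riccatiIntegrand hS hS' σ C hP x).comp hc
  set K := M ^ 2 * ‖P0‖ + τ * (M ^ 2 * (‖P‖ ^ 2 * ‖σ‖ ^ 2 + ‖C‖))
  have hK : 0 ≤ K := by positivity
  have hbound : ∀ x t, ‖(adjoint (S (Set.projIcc 0 τ hτ t)) ∘L P0 ∘L S (Set.projIcc 0 τ hτ t)) x +
        ∫ s in (0 : ℝ)..(Set.projIcc 0 τ hτ t),
          riccatiIntegrand S σ C (evalFamily P) (Set.projIcc 0 τ hτ t) s x‖ ≤ K * ‖x‖ := by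
    intro x t
    obtain ⟨h0, h1⟩ := (Set.projIcc 0 τ hτ t).2
    refine (norm_add_le _ _).trans ?_
    rw [add_mul]
    refine add_le_add (ContinuousLinearMap.le_of_opNorm_le _
      (norm_adjoint_comp_comp_le (hS.norm_le _) le_rfl) x) ?_
    refine (norm_integral_riccatiIntegrand_le hS σ C hP x h0).trans ?_
    gcongr
  refine ⟨LinearMap.mkContinuous
    { toFun x := BoundedContinuousFunction.ofNormedAddCommGroup _ (hcont x) (K * ‖x‖) (hbound x)
      map_add' x y := ?_
      map_smul' a x := ?_ } K fun x => ?_, fun x t => rfl⟩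
  · ext t
    simp only [BoundedContinuousFunction.coe_ofNormedAddCommGroup, map_add,
      BoundedContinuousFunction.coe_add, Pi.add_apply]
    rw [intervalIntegral.integral_add (intervalIntegrable_riccatiIntegrand hS hS' σ C hP _ _ _ _)
      (intervalIntegrable_riccatiIntegrand hS hS' σ C hP _ _ _ _)]
    abel
  · ext t
    simp only [BoundedContinuousFunction.coe_ofNormedAddCommGroup, map_smul,
      BoundedContinuousFunction.coe_smul, intervalIntegral.integral_smul, smul_add,
      RingHom.id_apply]
  · exact BoundedContinuousFunction.norm_ofNormedAddCommGroup_le _ (by positivity) (hbound x)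

include hS hS' hP in
theorem inner_integral_riccatiIntegrand_comm {C : X →L[ℝ] X} (hC : IsSelfAdjoint C)
    (hPs : ∀ t, IsSelfAdjoint (P t)) (t : ℝ) (x y : X) :
    ⟪∫ s in (0 : ℝ)..t, riccatiIntegrand S σ C P t s x, y⟫
      = ⟪x, ∫ s in (0 : ℝ)..t, riccatiIntegrand S σ C P t s y⟫ := by
  have h := intervalIntegrable_riccatiIntegrand hS hS' σ C hP
  have e₁ := (innerSL ℝ y).intervalIntegral_comp_comm (h x t 0 t)
  have e₂ := (innerSL ℝ x).intervalIntegral_comp_comm (h y t 0 t)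
  simp only [innerSL_apply_apply] at e₁ e₂
  rw [real_inner_comm, ← e₁, ← e₂]
  congr 1
  ext s
  rw [real_inner_comm]
  exact (isSelfAdjoint_riccatiIntegrand S σ hC t s (hPs s)).isSymmetric x y

include hS' hS in
theorem exists_riccati_fixedPoint {C P0 : X →L[ℝ] X} (hC : IsSelfAdjoint C)
    (hP0 : IsSelfAdjoint P0) {τ R : ℝ} (hτ : 0 ≤ τ)
    (hR : M ^ 2 * ‖P0‖ + τ * (M ^ 2 * (R ^ 2 * ‖σ‖ ^ 2 + ‖C‖)) ≤ R)
    (hτR : τ * (M ^ 2 * (2 * R * ‖σ‖ ^ 2)) ≤ 1 / 2) :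
    ∃ P : ℝ → X →L[ℝ] X, (∀ t, IsSelfAdjoint (P t)) ∧ (∀ x, Continuous fun t => P t x) ∧
      ∀ t ∈ Set.Icc 0 τ, ∀ x, P t x = (adjoint (S t) ∘L P0 ∘L S t) x +
        ∫ s in (0 : ℝ)..t, riccatiIntegrand S σ C P t s x := by
  have hR0 : 0 ≤ R := le_trans (by positivity) hR
  choose Φ hΦ using exists_picardMap hS hS' σ C P0 hτ
  set A : Set (StrongFamily X X) :=
    {P | ‖P‖ ≤ R} ∩ {P | ∀ t x y, ⟪P x t, y⟫ = ⟪x, P y t⟫}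
  have hbs : ∀ P ∈ A, IsBoundedStrong (evalFamily P) R := fun P hP =>
    (isBoundedStrong_evalFamily P).mono hP.1
  have hsa : ∀ P ∈ A, ∀ t, IsSelfAdjoint (evalFamily P t) := fun P hP t =>
    ContinuousLinearMap.isSelfAdjoint_iff_isSymmetric.2 fun x y => hP.2 t x y
  have hclosed : IsClosed A := by
    refine (isClosed_le (continuous_norm (E := StrongFamily X X)) continuous_const).inter ?_
    simp only [Set.ofPred_forall]
    refine isClosed_iInter fun t => isClosed_iInter fun x => isClosed_iInter fun y => ?_
    have h : ∀ x, Continuous fun P : StrongFamily X X => P x t := fun x =>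
      (BoundedContinuousFunction.evalCLM ℝ t).continuous.comp
        (ContinuousLinearMap.apply ℝ _ x).continuous
    exact isClosed_eq ((h x).inner continuous_const) (continuous_const.inner (h y))
  have hmaps : Set.MapsTo Φ A A := by
    intro P hP
    refine ⟨?_, fun t x y => ?_⟩
    · refine norm_le_of_norm_apply_apply_le hR0 fun x t => ?_
      obtain ⟨h0, h1⟩ := (Set.projIcc 0 τ hτ t).2
      rw [hΦ]
      refine le_trans ?_ (mul_le_mul_of_nonneg_right hR (norm_nonneg x))
      refine (norm_add_le _ _).trans ?_
      rw [add_mul]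
      refine add_le_add (ContinuousLinearMap.le_of_opNorm_le _
        (norm_adjoint_comp_comp_le (hS.norm_le _) le_rfl) x) ?_
      refine (norm_integral_riccatiIntegrand_le hS σ C (hbs P hP) x h0).trans ?_
      gcongr
    · rw [hΦ, hΦ, inner_add_left, inner_add_right,
        inner_integral_riccatiIntegrand_comm hS hS' σ (hbs P hP) hC (hsa P hP)]
      congr 1
      exact (isSelfAdjoint_adjoint_comp_comp hP0 _).isSymmetric x y
  have hcontr : ContractingWith (1 / 2) (hmaps.restrict Φ A A) := by
    refine ⟨by norm_num, hmaps.lipschitzOnWith_iff_restrict.1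
      (LipschitzOnWith.of_dist_le_mul fun P hP Q hQ => ?_)⟩
    rw [dist_eq_norm, dist_eq_norm]
    refine norm_le_of_norm_apply_apply_le (by positivity) fun x t => ?_
    obtain ⟨h0, h1⟩ := (Set.projIcc 0 τ hτ t).2
    have h := norm_integral_riccatiIntegrand_sub_le hS hS' σ C (hbs P hP) (hbs Q hQ) x h0
      (continuous_const (y := ‖P - Q‖)) fun s _ => by
        rw [evalFamily_sub]
        exact norm_evalFamily_le _ _
    rw [sub_apply, BoundedContinuousFunction.sub_apply, hΦ, hΦ, add_sub_add_left_eq_sub]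
    refine h.trans ?_
    gcongr
    rw [intervalIntegral.integral_const, sub_zero, smul_eq_mul, ← mul_assoc]
    gcongr
    refine le_trans ?_ (hτR.trans_eq (by simp))
    gcongr
  have hA0 : (0 : StrongFamily X X) ∈ A :=
    ⟨(norm_zero (E := StrongFamily X X)).trans_le hR0, fun t x y => by simp⟩
  obtain ⟨P, hPA, hfix, -⟩ := hcontr.exists_fixedPoint' hclosed.isComplete hmaps hA0
    (edist_ne_top _ _)
  refine ⟨evalFamily P, hsa P hPA, fun x => (P x).continuous, fun t ht x => ?_⟩
  have h := hΦ P x t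
  rw [hfix.eq, Set.projIcc_of_mem hτ ht] at h
  exact h

include hS' hS in
theorem riccati_mild_unique {P0 : X →L[ℝ] X} {τ : ℝ} (hP : IsBoundedStrong P R)
    (hQ : IsBoundedStrong Q R)
    (hPe : ∀ t ∈ Set.Icc 0 τ, ∀ x, P t x = (adjoint (S t) ∘L P0 ∘L S t) x +
      ∫ s in (0 : ℝ)..t, riccatiIntegrand S σ C P t s x)
    (hQe : ∀ t ∈ Set.Icc 0 τ, ∀ x, Q t x = (adjoint (S t) ∘L P0 ∘L S t) x +
      ∫ s in (0 : ℝ)..t, riccatiIntegrand S σ C Q t s x) :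
    ∀ t ∈ Set.Icc 0 τ, P t = Q t := by
  have h := nonpos_of_volterra_le (d := fun t => ‖P t - Q t‖) (τ := τ) (D := R + R)
    (κ := M ^ 2 * (2 * R * ‖σ‖ ^ 2))
    (fun t _ => (norm_sub_le _ _).trans (add_le_add (hP.norm_le t) (hQ.norm_le t)))
    fun g hg hle t ht => by
      have hR := hP.nonneg
      refine ContinuousLinearMap.opNorm_le_bound _ ?_ fun x => ?_
      · refine intervalIntegral.integral_nonneg ht.1 fun s hs => ?_
        have := (norm_nonneg _).trans (hle s ⟨hs.1, hs.2.trans ht.2⟩)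
        positivity
      · rw [sub_apply, hPe t ht, hQe t ht, add_sub_add_left_eq_sub]
        exact norm_integral_riccatiIntegrand_sub_le hS hS' σ C hP hQ x ht.1 hg
          fun s hs => hle s ⟨hs.1, hs.2.trans ht.2⟩
  exact fun t ht => sub_eq_zero.1 (norm_le_zero_iff.1 (h t ht))

/-- The integral in the mild Riccati equation on `[0,τ]` depends only on the values of the
semigroup and of the solution on `[0,τ]`. -/
theorem integral_riccatiIntegrand_congr {S' P' : ℝ → X →L[ℝ] X} {τ : ℝ}
    (hSS' : Set.EqOn S S' (Set.Icc 0 τ)) (hPP' : Set.EqOn P P' (Set.Icc 0 τ))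
    {t : ℝ} (ht : t ∈ Set.Icc 0 τ) (x : X) :
    ∫ s in (0 : ℝ)..t, riccatiIntegrand S σ C P t s x
      = ∫ s in (0 : ℝ)..t, riccatiIntegrand S' σ C P' t s x := by
  refine intervalIntegral.integral_congr fun s hs => ?_
  rw [Set.uIcc_of_le ht.1] at hs
  simp only [riccatiIntegrand]
  rw [hSS' ⟨sub_nonneg.2 hs.2, by linarith [hs.1, ht.2]⟩, hPP' ⟨hs.1, hs.2.trans ht.2⟩]

end Riccati

/-- Local existence and uniqueness of mild solutions of the
operator differential Riccati equation, for any self-adjoint initial condition. -/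
theorem riccati_local_existence_uniqueness {X W : Type*}
    [NormedAddCommGroup X] [InnerProductSpace ℝ X] [CompleteSpace X]
    [NormedAddCommGroup W] [InnerProductSpace ℝ W] [CompleteSpace W]
    (T : ℝ → X →L[ℝ] X) (hT : IsC0Semigroup T)
    (hT' : ∀ x : X, ContinuousOn (fun t => ContinuousLinearMap.adjoint (T t) x) (Set.Ici 0))
    (σ : W →L[ℝ] X) (C : X →L[ℝ] X) (hC : IsSelfAdjoint C)
    (P0 : X →L[ℝ] X) (hP0 : IsSelfAdjoint P0) :
    ∃ τ : ℝ, 0 < τ ∧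
      (∃ P : ℝ → X →L[ℝ] X, P 0 = P0 ∧ IsMildRiccatiSolution T σ C τ P) ∧
      ∀ P₁ P₂ : ℝ → X →L[ℝ] X,
        P₁ 0 = P0 → IsMildRiccatiSolution T σ C τ P₁ →
        P₂ 0 = P0 → IsMildRiccatiSolution T σ C τ P₂ →
        ∀ t ∈ Set.Icc (0:ℝ) τ, P₁ t = P₂ t := by
  have hcl : Set.Icc (0 : ℝ) 1 ⊆ Set.Ici 0 := Set.Icc_subset_Ici_self
  obtain ⟨M₁, hM₁⟩ := IsBoundedStrong.exists_projIcc zero_le_one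
    fun x => (hT.2.2 x).mono hcl
  obtain ⟨M₂, hM₂⟩ := IsBoundedStrong.exists_projIcc zero_le_one
    fun x => (hT' x).mono hcl
  set S : ℝ → X →L[ℝ] X := fun t => T (Set.projIcc 0 1 zero_le_one t) with hSdef
  set M := max M₁ M₂
  have hS : IsBoundedStrong S M := hM₁.mono (le_max_left _ _)
  have hS' : IsBoundedStrong (fun t => ContinuousLinearMap.adjoint (S t)) M :=
    hM₂.mono (le_max_right _ _)
  set R := M ^ 2 * ‖P0‖ + 1
  have hR : 0 ≤ R := by positivity
  set a := M ^ 2 * (R ^ 2 * ‖σ‖ ^ 2 + ‖C‖)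
  set b := M ^ 2 * (2 * R * ‖σ‖ ^ 2)
  have ha : 0 ≤ a := by positivity
  have hb : 0 ≤ b := by positivity
  set τ := 1 / (1 + a + 2 * b)
  have hτ : 0 < τ := by positivity
  have hτ1 : τ ≤ 1 := (div_le_one (by positivity)).2 (by linarith)
  have hTS : Set.EqOn T S (Set.Icc 0 τ) := fun t ht => by
    simp only [hSdef]
    rw [Set.projIcc_of_mem zero_le_one ⟨ht.1, ht.2.trans hτ1⟩]
  refine ⟨τ, hτ, ?_, ?_⟩
  · have hτa : τ * a ≤ 1 := by
      rw [one_div_mul_eq_div, div_le_one (by positivity)]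
      linarith
    have hτb : τ * b ≤ 1 / 2 := by
      rw [one_div_mul_eq_div, div_le_iff₀ (by positivity)]
      linarith
    obtain ⟨P, hPs, hPc, hPe⟩ := exists_riccati_fixedPoint hS hS' σ hC hP0 hτ.le
      (by linarith) hτb
    have h0 : P 0 = P0 := by
      ext x
      rw [hPe 0 ⟨le_rfl, hτ.le⟩ x, ← hTS ⟨le_rfl, hτ.le⟩, hT.1]
      simp [ContinuousLinearMap.one_def, ContinuousLinearMap.adjoint_id]
    refine ⟨P, h0, fun t _ => hPs t, fun x => (hPc x).continuousOn, fun t ht x => ?_⟩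
    rw [hPe t ht x, h0, ← hTS ht,
      ← integral_riccatiIntegrand_congr σ C hTS (Set.eqOn_refl P _) ht x]
    rfl
  · intro P₁ P₂ h₁0 h₁ h₂0 h₂
    obtain ⟨R₁, hR₁⟩ := IsBoundedStrong.exists_projIcc hτ.le h₁.2.1
    obtain ⟨R₂, hR₂⟩ := IsBoundedStrong.exists_projIcc hτ.le h₂.2.1
    have hext : ∀ P : ℝ → X →L[ℝ] X,
        Set.EqOn P (fun t => P (Set.projIcc 0 τ hτ.le t)) (Set.Icc 0 τ) := fun P t ht => by
      simp only
      rw [Set.projIcc_of_mem hτ.le ht]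
    have heq : ∀ P : ℝ → X →L[ℝ] X, P 0 = P0 → IsMildRiccatiSolution T σ C τ P →
        ∀ t ∈ Set.Icc 0 τ, ∀ x, P (Set.projIcc 0 τ hτ.le t) x
          = (ContinuousLinearMap.adjoint (S t) ∘L P0 ∘L S t) x +
            ∫ s in (0 : ℝ)..t,
              riccatiIntegrand S σ C (fun t => P (Set.projIcc 0 τ hτ.le t)) t s x := by
      intro P hP0 hP t ht x
      rw [← integral_riccatiIntegrand_congr σ C hTS (hext P) ht x, ← hTS ht,
        Set.projIcc_of_mem hτ.le ht, hP.2.2 t ht x, hP0]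
      rfl
    intro t ht
    have h := riccati_mild_unique hS hS' σ C (hR₁.mono (le_max_left R₁ R₂))
      (hR₂.mono (le_max_right R₁ R₂)) (heq P₁ h₁0 h₁) (heq P₂ h₂0 h₂) t ht
    simpa only [Set.projIcc_of_mem hτ.le ht] using h
end

section
/- Let X and W be real Hilbert spaces, T a C0-semigroup on X whose adjoint family is strongly continuous, σ ∈ B(W,X), and C ∈ B(X) self-adjoint. Let M ∈ Σ(X) and τ₀ > 0 be such that the unique mild solution P of the operator differential Riccati equation on [0,τ₀] with P(0) = M satisfies: P(t) − M is coercive for every t ∈ (0,τ₀]. Then for every self-adjoint M̃ ∈ B(X) such that M̃ − M is coercive, there exists τ₁ ∈ (0,τ₀] such that there is a unique mild solution P̃ of the operator differential Riccati equation on [0,τ₁] with P̃(0) = M̃, and moreover P̃(t) − M is coercive for every t ∈ (0,τ₁]. -/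
open RealInnerProductSpace MeasureTheory

/-- A bounded operator `F` is coercive if `⟨x, F x⟩ ≥ ε ‖x‖²` for some `ε > 0`. -/
def Coercive {X : Type*} [NormedAddCommGroup X] [InnerProductSpace ℝ X]
    (F : X →L[ℝ] X) : Prop :=
  ∃ ε : ℝ, 0 < ε ∧ ∀ x : X, ε * ‖x‖ ^ 2 ≤ ⟪x, F x⟫

open Set Filter Topology ContinuousLinearMap

theorem exists_norm_bound_of_strongly_continuousOn {X E : Type*} [NormedAddCommGroup X]
    [NormedSpace ℝ X] [CompleteSpace X] [NormedAddCommGroup E] [NormedSpace ℝ E]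
    {F : ℝ → X →L[ℝ] E} {a b : ℝ} (hF : ∀ x, ContinuousOn (fun t => F t x) (Icc a b)) :
    ∃ B : ℝ, 0 ≤ B ∧ ∀ t ∈ Icc a b, ‖F t‖ ≤ B := by
  obtain ⟨B, hB⟩ := banach_steinhaus (g := fun t : Icc a b => F t) fun x => by
    obtain ⟨B, hB⟩ := isCompact_Icc.exists_bound_of_continuousOn (hF x)
    exact ⟨B, fun t => hB t t.2⟩
  exact ⟨max B 0, le_max_right _ _, fun t ht => (hB ⟨t, ht⟩).trans (le_max_left _ _)⟩

theorem continuous_uncurry_of_strongly_continuous {X E : Type*} [NormedAddCommGroup X]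
    [NormedSpace ℝ X] [CompleteSpace X] [NormedAddCommGroup E] [NormedSpace ℝ E]
    {F : ℝ → X →L[ℝ] E} (hF : ∀ x, Continuous fun t => F t x) :
    Continuous fun p : ℝ × X => F p.1 p.2 := by
  rw [continuous_iff_continuousAt]
  rintro ⟨t₀, x₀⟩
  obtain ⟨B, -, hB⟩ := exists_norm_bound_of_strongly_continuousOn
    (a := t₀ - 1) (b := t₀ + 1) fun x => (hF x).continuousOn
  have hsmall : Tendsto (fun p : ℝ × X => F p.1 (p.2 - x₀)) (𝓝 (t₀, x₀)) (𝓝 0) := by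
    have hlim : Tendsto (fun p : ℝ × X => B * ‖p.2 - x₀‖) (𝓝 (t₀, x₀)) (𝓝 0) := by
      have : Continuous fun p : ℝ × X => B * ‖p.2 - x₀‖ := by fun_prop
      simpa using this.tendsto (t₀, x₀)
    refine squeeze_zero_norm' ?_ hlim
    have hmem : ∀ᶠ p : ℝ × X in 𝓝 (t₀, x₀), p.1 ∈ Icc (t₀ - 1) (t₀ + 1) :=
      continuous_fst.continuousAt.eventually
        (Icc_mem_nhds (by simp) (by simp))
    filter_upwards [hmem] with p hp
    exact (F p.1).le_of_opNorm_le (hB _ hp) _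
  have hpt : Tendsto (fun p : ℝ × X => F p.1 x₀) (𝓝 (t₀, x₀)) (𝓝 (F t₀ x₀)) :=
    ((hF x₀).comp continuous_fst).tendsto (t₀, x₀)
  simpa [ContinuousAt] using hsmall.add hpt

theorem Continuous.strongly_apply {X E Y : Type*} [NormedAddCommGroup X]
    [NormedSpace ℝ X] [CompleteSpace X] [NormedAddCommGroup E] [NormedSpace ℝ E]
    [TopologicalSpace Y] {F : ℝ → X →L[ℝ] E} (hF : ∀ x, Continuous fun t => F t x)
    {φ : Y → ℝ} {g : Y → X} (hφ : Continuous φ) (hg : Continuous g) :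
    Continuous fun y => F (φ y) (g y) :=
  (continuous_uncurry_of_strongly_continuous hF).comp (hφ.prodMk hg)

theorem hasDerivAt_integral_diagonal {E : Type*} [NormedAddCommGroup E] [NormedSpace ℝ E]
    [CompleteSpace E] {G : ℝ → ℝ → E} (hG : Continuous fun p : ℝ × ℝ => G p.1 p.2) (r : ℝ) :
    HasDerivAt (fun y => ∫ ρ in r..y, G y ρ) (G r r) r := by
  rw [hasDerivAt_iff_isLittleO, Asymptotics.isLittleO_iff]
  intro ε hε
  obtain ⟨δ, hδ, h⟩ := Metric.continuousAt_iff.1 (hG.continuousAt (x := (r, r))) ε hε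
  filter_upwards [Metric.ball_mem_nhds r hδ] with y hy
  have hy' : |y - r| < δ := by simpa [Real.dist_eq] using hy
  have hint : IntervalIntegrable (fun ρ => G y ρ) volume r y :=
    (hG.comp (by fun_prop : Continuous fun ρ => (y, ρ))).intervalIntegrable _ _
  have key : ∫ ρ in r..y, (G y ρ - G r r) = (∫ ρ in r..y, G y ρ) - (y - r) • G r r := by
    rw [intervalIntegral.integral_sub hint intervalIntegrable_const,
      intervalIntegral.integral_const]
  rw [intervalIntegral.integral_same, sub_zero, ← key]
  refine intervalIntegral.norm_integral_le_of_norm_le_const fun ρ hρ => ?_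
  have hρ' : |ρ - r| ≤ |y - r| := abs_sub_left_of_mem_uIcc (uIoc_subset_uIcc hρ)
  have := h (x := (y, ρ)) (by
    rw [Prod.dist_eq, Real.dist_eq, Real.dist_eq]; exact max_lt hy' (hρ'.trans_lt hy'))
  rw [dist_eq_norm] at this
  exact this.le

theorem HasDerivAt.inner_of_eq_zero {X : Type*} [NormedAddCommGroup X] [InnerProductSpace ℝ X]
    {b w : ℝ → X} {b' : X} {r : ℝ} (hb : HasDerivAt b b' r) (hb0 : b r = 0)
    (hw : ContinuousAt w r) : HasDerivAt (fun y => ⟪b y, w y⟫) ⟪b', w r⟫ r := by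
  rw [hasDerivAt_iff_tendsto_slope] at hb ⊢
  refine (hb.inner (hw.tendsto.mono_left nhdsWithin_le_nhds)).congr fun y => ?_
  simp [slope, hb0, real_inner_smul_left]

/-- Two-sided energy identity in quadratic form: if `D` solves the mild Lyapunov equation with
source `F`, where `⟪y, F s y⟫ = 2 ⟪K s y, D s y⟫`, then the value of the form `D t` at `z 0`
equals that of `D 0` at `z t` along a mild trajectory `z` of the generator perturbed by `K`. -/
theorem inner_mild_lyapunov_eq {X : Type*} [NormedAddCommGroup X] [InnerProductSpace ℝ X]
    [CompleteSpace X] {T D F K : ℝ → X →L[ℝ] X} {z : ℝ → X} {t : ℝ}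
    (hT0 : T 0 = 1) (hTadd : ∀ r s : ℝ, 0 ≤ r → 0 ≤ s → T (r + s) = T r ∘L T s)
    (hT : ∀ x, Continuous fun s => T s x) (hTa : ∀ x, Continuous fun s => adjoint (T s) x)
    (hD : ∀ x, Continuous fun s => D s x) (hF : ∀ x, Continuous fun s => F s x)
    (hK : ∀ x, Continuous fun s => K s x) (hz : Continuous z) (ht : 0 ≤ t)
    (hDsa : ∀ s ∈ Icc 0 t, IsSelfAdjoint (D s))
    (hDmild : ∀ s ∈ Icc 0 t, ∀ x, D s x = adjoint (T s) (D 0 (T s x)) +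
      ∫ ρ in (0 : ℝ)..s, adjoint (T (s - ρ)) (F ρ (T (s - ρ) x)))
    (hFK : ∀ s ∈ Icc 0 t, ∀ y, ⟪y, F s y⟫ = 2 * ⟪K s y, D s y⟫)
    (hzmild : ∀ r ∈ Icc 0 t, z r = T r (z 0) +
      ∫ ρ in (0 : ℝ)..r, T (r - ρ) (K (t - ρ) (z ρ))) :
    ⟪z 0, D t (z 0)⟫ = ⟪z t, D 0 (z t)⟫ := by
  have hf : Continuous fun ρ => K (t - ρ) (z ρ) :=
    Continuous.strongly_apply hK (by fun_prop) hz
  have hTf : Continuous fun p : ℝ × ℝ => T (p.1 - p.2) (K (t - p.2) (z p.2)) :=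
    Continuous.strongly_apply hT (by fun_prop) (hf.comp continuous_snd)
  have hTf' : ∀ y, Continuous fun ρ => T (y - ρ) (K (t - ρ) (z ρ)) := fun y =>
    hTf.comp (by fun_prop : Continuous fun ρ => (y, ρ))
  have hTF : ∀ s x, Continuous fun ρ => adjoint (T (s - ρ)) (F ρ (T (s - ρ) x)) := fun s x =>
    Continuous.strongly_apply hTa (by fun_prop)
      (Continuous.strongly_apply hF continuous_id ((hT x).comp (by fun_prop)))
  have hzstep : ∀ r y, 0 ≤ r → r ≤ y → y ≤ t →
      z y = T (y - r) (z r) + ∫ ρ in r..y, T (y - ρ) (K (t - ρ) (z ρ)) := by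
    intro r y hr hry hyt
    rw [hzmild y ⟨hr.trans hry, hyt⟩, hzmild r ⟨hr, hry.trans hyt⟩,
      ← intervalIntegral.integral_add_adjacent_intervals ((hTf' y).intervalIntegrable 0 r)
        ((hTf' y).intervalIntegrable r y), map_add, ← add_assoc]
    congr 2
    · rw [← ContinuousLinearMap.comp_apply, ← hTadd _ _ (sub_nonneg.2 hry) hr, sub_add_cancel]
    · rw [← ContinuousLinearMap.intervalIntegral_comp_comm _ ((hTf' r).intervalIntegrable 0 r)]
      refine intervalIntegral.integral_congr fun ρ hρ => ?_
      rw [uIcc_of_le hr] at hρ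
      rw [← sub_add_sub_cancel y r ρ, hTadd _ _ (sub_nonneg.2 hry) (sub_nonneg.2 hρ.2)]
      rfl
  have hDstep : ∀ q s, 0 ≤ q → q ≤ s → s ≤ t → ∀ x,
      D s x = adjoint (T (s - q)) (D q (T (s - q) x)) +
        ∫ ρ in q..s, adjoint (T (s - ρ)) (F ρ (T (s - ρ) x)) := by
    intro q s hq hqs hst x
    have hcomp : ∀ ρ, ρ ≤ q → T (s - ρ) = T (q - ρ) ∘L T (s - q) := fun ρ hρ => by
      rw [← hTadd _ _ (sub_nonneg.2 hρ) (sub_nonneg.2 hqs)]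
      congr 1; ring
    rw [hDmild s ⟨hq.trans hqs, hst⟩, hDmild q ⟨hq, hqs.trans hst⟩,
      ← intervalIntegral.integral_add_adjacent_intervals ((hTF s x).intervalIntegrable 0 q)
        ((hTF s x).intervalIntegrable q s), map_add, ← add_assoc]
    congr 2
    · have := hcomp 0 hq
      rw [sub_zero, sub_zero] at this
      rw [this, adjoint_comp]; rfl
    · rw [← ContinuousLinearMap.intervalIntegral_comp_comm _ ((hTF q _).intervalIntegrable 0 q)]
      refine intervalIntegral.integral_congr fun ρ hρ => ?_
      rw [uIcc_of_le hq] at hρ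
      rw [hcomp ρ hρ.2, adjoint_comp]; rfl
  have hDz : Continuous fun r => D (t - r) (z r) := Continuous.strongly_apply hD (by fun_prop) hz
  have hv := constant_of_has_deriv_right_zero (f := fun r => ⟪z r, D (t - r) (z r)⟫)
    (a := 0) (b := t) (hz.inner hDz).continuousOn ?_ t ⟨ht, le_rfl⟩
  · simpa using hv.symm
  rintro r ⟨hr, hrt⟩
  have hb : HasDerivAt (fun y => ∫ ρ in r..y, T (y - ρ) (K (t - ρ) (z ρ)))
      (K (t - r) (z r)) r := by
    simpa [hT0] using hasDerivAt_integral_diagonal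
      (G := fun y ρ => T (y - ρ) (K (t - ρ) (z ρ))) hTf r
  have hw : ContinuousAt (fun y => D (t - y) ((2 : ℝ) • T (y - r) (z r) +
      ∫ ρ in r..y, T (y - ρ) (K (t - ρ) (z ρ)))) r := by
    refine (Continuous.strongly_apply hD (by fun_prop) ?_).continuousAt
    exact (((hT _).comp (by fun_prop)).const_smul _).add
      (intervalIntegral.continuous_parametric_intervalIntegral_of_continuous hTf continuous_id)
  have hbw := hb.inner_of_eq_zero intervalIntegral.integral_same hw
  set g : ℝ → ℝ := fun ρ => ⟪z r, adjoint (T (t - r - ρ)) (F ρ (T (t - r - ρ) (z r)))⟫ with hg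
  have hgc : Continuous g := continuous_const.inner (hTF _ _)
  have hG : HasDerivAt (fun y => ∫ ρ in (t - r)..(t - y), g ρ) (-g (t - r)) r := by
    have h1 := (hgc.integral_hasStrictDerivAt (t - r) (t - r)).hasDerivAt
    have h2 : HasDerivAt (fun y : ℝ => t - y) (-1) r := (hasDerivAt_id r).const_sub t
    simpa [Function.comp_def] using h1.scomp r h2
  have hsum := (hbw.add hG).const_add ⟪z r, D (t - r) (z r)⟫
  have hval : ⟪K (t - r) (z r), D (t - r) ((2 : ℝ) • T (r - r) (z r) +
      ∫ ρ in r..r, T (r - ρ) (K (t - ρ) (z ρ)))⟫ + -g (t - r) = 0 := by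
    have := hFK (t - r) ⟨by linarith, by linarith⟩ (z r)
    have h1 : adjoint (1 : X →L[ℝ] X) = 1 := star_one _
    simp [hg, hT0, h1, real_inner_smul_right, this]
  rw [hval] at hsum
  refine hsum.hasDerivWithinAt.congr_of_eventuallyEq ?_ ?_
  · filter_upwards [Icc_mem_nhdsGE hrt] with y hy
    have hzy := hzstep r y hr hy.1 hy.2
    have hDy := hDstep (t - y) (t - r) (by linarith [hy.2]) (by linarith [hy.1]) (by linarith) (z r)
    have hgi : ⟪z r, ∫ ρ in (t - y)..(t - r),
        adjoint (T (t - r - ρ)) (F ρ (T (t - r - ρ) (z r)))⟫ = ∫ ρ in (t - y)..(t - r), g ρ :=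
      ((innerSL ℝ (z r)).intervalIntegral_comp_comm
        ((hTF _ _).intervalIntegrable _ _)).symm
    have e : t - r - (t - y) = y - r := by ring
    rw [e] at hDy
    set b := ∫ ρ in r..y, T (y - ρ) (K (t - ρ) (z ρ))
    have hsym : ⟪T (y - r) (z r), D (t - y) b⟫ = ⟪b, D (t - y) (T (y - r) (z r))⟫ := by
      rw [real_inner_comm]
      exact (hDsa (t - y) ⟨by linarith [hy.2], by linarith [hy.1]⟩).isSymmetric b _
    rw [Pi.add_apply, hzy, hDy, inner_add_right (z r), hgi, adjoint_inner_right,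
      intervalIntegral.integral_symm (t - y) (t - r)]
    change _ = _ + (⟪b, D (t - y) ((2 : ℝ) • T (y - r) (z r) + b)⟫ + _)
    simp only [map_add, inner_add_left, inner_add_right, map_smul, real_inner_smul_right, hsym]
    ring
  · simp

theorem exists_perturbed_trajectory {X : Type*} [NormedAddCommGroup X] [NormedSpace ℝ X]
    [CompleteSpace X] {T K : ℝ → X →L[ℝ] X} {t m k : ℝ} (hT : ∀ x, Continuous fun s => T s x)
    (hK : ∀ x, Continuous fun s => K s x) (ht : 0 ≤ t) (hm : ∀ s ∈ Icc 0 t, ‖T s‖ ≤ m)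
    (hk : ∀ s ∈ Icc 0 t, ‖K s‖ ≤ k) (hsmall : t * (m * k) ≤ 1 / 2) (x : X) :
    ∃ z : ℝ → X, Continuous z ∧ ∀ r ∈ Icc 0 t,
      z r = T r x + ∫ ρ in (0 : ℝ)..r, T (r - ρ) (K ρ (z ρ)) := by
  have hm0 : 0 ≤ m := (norm_nonneg _).trans (hm 0 ⟨le_rfl, ht⟩)
  have hk0 : 0 ≤ k := (norm_nonneg _).trans (hk 0 ⟨le_rfl, ht⟩)
  set c : ℝ → ℝ := fun r => max 0 (min t r) with hc
  have hcc : Continuous c := by fun_prop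
  have hcmem : ∀ r, c r ∈ Icc 0 t := fun r =>
    ⟨le_max_left _ _, max_le ht (min_le_left _ _)⟩
  have hint : ∀ z : ℝ → X, Continuous z →
      Continuous fun p : ℝ × ℝ => T (c p.1 - p.2) (K p.2 (z p.2)) := fun z hz =>
    Continuous.strongly_apply hT (by fun_prop)
      (Continuous.strongly_apply hK (by fun_prop) (by fun_prop))
  have hbound : ∀ r, ∀ ρ ∈ uIoc 0 (c r), ∀ y, ‖T (c r - ρ) (K ρ y)‖ ≤ m * (k * ‖y‖) := by
    intro r ρ hρ y
    rw [uIoc_of_le (hcmem r).1] at hρ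
    have h := (hcmem r).2
    exact (T _).le_of_opNorm_le_of_le (hm _ ⟨by linarith [hρ.2], by linarith [hρ.1]⟩)
      ((K ρ).le_of_opNorm_le (hk ρ ⟨hρ.1.le, hρ.2.trans h⟩) y)
  have hΨ : ∀ z : BoundedContinuousFunction ℝ X, ∃ w : BoundedContinuousFunction ℝ X,
      ∀ r, w r = T (c r) x + ∫ ρ in (0 : ℝ)..c r, T (c r - ρ) (K ρ (z ρ)) := by
    intro z
    refine ⟨BoundedContinuousFunction.ofNormedAddCommGroup _ (((hT x).comp hcc).add
      (intervalIntegral.continuous_parametric_intervalIntegral_of_continuous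
        (f := fun r ρ => T (c r - ρ) (K ρ (z ρ))) (hint z z.continuous) hcc))
      (m * ‖x‖ + m * (k * ‖z‖) * t) fun r => ?_, fun r => rfl⟩
    refine (norm_add_le _ _).trans (add_le_add ((T _).le_of_opNorm_le (hm _ (hcmem r)) x) ?_)
    refine (intervalIntegral.norm_integral_le_of_norm_le_const (C := m * (k * ‖z‖)) fun ρ hρ =>
      (hbound r ρ hρ _).trans (by gcongr; exact z.norm_coe_le_norm ρ)).trans ?_
    rw [sub_zero, abs_of_nonneg (hcmem r).1]
    gcongr
    exact (hcmem r).2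
  choose Ψ hΨ using hΨ
  have hcontr : ContractingWith (1 / 2) Ψ := by
    refine ⟨by norm_num, LipschitzWith.of_dist_le_mul fun z w => ?_⟩
    rw [BoundedContinuousFunction.dist_le (by positivity)]
    intro r
    have hi : ∀ z : BoundedContinuousFunction ℝ X, IntervalIntegrable
        (fun ρ => T (c r - ρ) (K ρ (z ρ))) volume 0 (c r) := fun z =>
      ((hint z z.continuous).comp (by fun_prop : Continuous fun ρ => (r, ρ))).intervalIntegrable _ _
    rw [dist_eq_norm, hΨ, hΨ, add_sub_add_left_eq_sub, ← intervalIntegral.integral_sub (hi z) (hi w)]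
    simp_rw [← map_sub]
    refine (intervalIntegral.norm_integral_le_of_norm_le_const (C := m * (k * dist z w))
      fun ρ hρ => (hbound r ρ hρ _).trans ?_).trans ?_
    · gcongr
      rw [← dist_eq_norm]
      exact z.dist_coe_le_dist ρ
    · rw [sub_zero, abs_of_nonneg (hcmem r).1]
      calc m * (k * dist z w) * c r ≤ m * (k * dist z w) * t := by gcongr; exact (hcmem r).2
        _ = t * (m * k) * dist z w := by ring
        _ ≤ _ := by
          push_cast
          gcongr
  set z := ContractingWith.fixedPoint Ψ hcontr with hz
  refine ⟨z, z.continuous, fun r hr => ?_⟩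
  have h := hΨ z r
  have hcr : c r = r := by simp [hc, hr.1, hr.2]
  rwa [hz, hcontr.fixedPoint_isFixedPt.eq, hcr] at h

theorem exists_boundedContinuous_family {X : Type*} [NormedAddCommGroup X] [NormedSpace ℝ X]
    {G : ℝ → X → X} {B : ℝ} (hB : 0 ≤ B)
    (hadd : ∀ t x y, G t (x + y) = G t x + G t y) (hsmul : ∀ t (a : ℝ) x, G t (a • x) = a • G t x)
    (hcont : ∀ x, Continuous fun t => G t x) (hbound : ∀ t x, ‖G t x‖ ≤ B * ‖x‖) :
    ∃ P : X →L[ℝ] BoundedContinuousFunction ℝ X, (∀ x t, P x t = G t x) ∧ ‖P‖ ≤ B := by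
  let L : X →ₗ[ℝ] BoundedContinuousFunction ℝ X :=
    { toFun := fun x => BoundedContinuousFunction.ofNormedAddCommGroup (fun t => G t x) (hcont x)
        (B * ‖x‖) fun t => hbound t x
      map_add' := fun x y => by ext t; exact hadd t x y
      map_smul' := fun a x => by ext t; exact hsmul t a x }
  refine ⟨L.mkContinuous B fun x => ?_, fun x t => rfl, LinearMap.mkContinuous_norm_le _ hB _⟩
  exact BoundedContinuousFunction.norm_ofNormedAddCommGroup_le _ (by positivity) fun t => hbound t x

/-- Evaluation at time `t` of a bounded strongly continuous operator family. -/
noncomputable def familyEval {X : Type*} [NormedAddCommGroup X] [NormedSpace ℝ X]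
    (P : X →L[ℝ] BoundedContinuousFunction ℝ X) (t : ℝ) : X →L[ℝ] X :=
  BoundedContinuousFunction.evalCLM ℝ t ∘L P

@[simp]
theorem familyEval_apply {X : Type*} [NormedAddCommGroup X] [NormedSpace ℝ X]
    (P : X →L[ℝ] BoundedContinuousFunction ℝ X) (t : ℝ) (x : X) :
    familyEval P t x = P x t := rfl

theorem norm_familyEval_le {X : Type*} [NormedAddCommGroup X] [NormedSpace ℝ X]
    (P : X →L[ℝ] BoundedContinuousFunction ℝ X) (t : ℝ) :
    ‖familyEval P t‖ ≤ ‖P‖ :=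
  opNorm_le_bound _ (norm_nonneg P) fun x =>
    ((P x).norm_coe_le_norm t).trans (P.le_opNorm x)

theorem familyEval_sub {X : Type*} [NormedAddCommGroup X] [NormedSpace ℝ X]
    (P Q : X →L[ℝ] BoundedContinuousFunction ℝ X) (t : ℝ) :
    familyEval P t - familyEval Q t = familyEval (P - Q) t := rfl

theorem continuous_familyEval {X : Type*} [NormedAddCommGroup X] [NormedSpace ℝ X]
    (P : X →L[ℝ] BoundedContinuousFunction ℝ X) (x : X) :
    Continuous fun t => familyEval P t x := (P x).continuous

section Riccati

variable {X W : Type*} [NormedAddCommGroup X] [InnerProductSpace ℝ X] [CompleteSpace X]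
  [NormedAddCommGroup W] [InnerProductSpace ℝ W] [CompleteSpace W]

/-- The right-hand side `P σ σ' P + C` of the Riccati equation. -/
noncomputable def riccatiTerm (σ : W →L[ℝ] X) (C P : X →L[ℝ] X) : X →L[ℝ] X :=
  P ∘L σ ∘L adjoint σ ∘L P + C

theorem norm_riccatiTerm_le (σ : W →L[ℝ] X) (C P : X →L[ℝ] X) :
    ‖riccatiTerm σ C P‖ ≤ ‖P‖ * (‖σ ∘L adjoint σ‖ * ‖P‖) + ‖C‖ := by
  refine (norm_add_le _ _).trans (add_le_add_left ?_ _)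
  exact (opNorm_comp_le P ((σ ∘L adjoint σ) ∘L P)).trans
    (by gcongr; exact opNorm_comp_le _ _)

theorem norm_riccatiTerm_sub_le (σ : W →L[ℝ] X) (C P Q : X →L[ℝ] X) :
    ‖riccatiTerm σ C P - riccatiTerm σ C Q‖ ≤ ‖σ ∘L adjoint σ‖ * (‖P‖ + ‖Q‖) * ‖P - Q‖ := by
  have h : riccatiTerm σ C P - riccatiTerm σ C Q =
      P ∘L (σ ∘L adjoint σ) ∘L (P - Q) + (P - Q) ∘L (σ ∘L adjoint σ) ∘L Q := by
    ext x; simp [riccatiTerm]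
  rw [h]
  refine (norm_add_le _ _).trans ?_
  calc _ ≤ ‖P‖ * (‖σ ∘L adjoint σ‖ * ‖P - Q‖) + ‖P - Q‖ * (‖σ ∘L adjoint σ‖ * ‖Q‖) := by
        refine add_le_add ((opNorm_comp_le _ _).trans ?_) ((opNorm_comp_le _ _).trans ?_)
        · gcongr; exact opNorm_comp_le _ _
        · gcongr; exact opNorm_comp_le _ _
    _ = _ := by ring

theorem inner_riccatiTerm_left {σ : W →L[ℝ] X} {C P : X →L[ℝ] X} (hC : IsSelfAdjoint C)
    (hP : ∀ x y, ⟪P x, y⟫ = ⟪x, P y⟫) (x y : X) :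
    ⟪riccatiTerm σ C P x, y⟫ = ⟪x, riccatiTerm σ C P y⟫ := by
  have h : ⟪C x, y⟫ = ⟪x, C y⟫ := hC.isSymmetric x y
  simp only [riccatiTerm, add_apply, ContinuousLinearMap.comp_apply, inner_add_left,
    inner_add_right, h, hP]
  rw [← adjoint_inner_right, adjoint_inner_left, ← hP]

theorem riccatiTerm_strongly_continuous (σ : W →L[ℝ] X) (C : X →L[ℝ] X) {P : ℝ → X →L[ℝ] X}
    (hP : ∀ x, Continuous fun s => P s x) (x : X) :
    Continuous fun s => riccatiTerm σ C (P s) x :=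
  (Continuous.strongly_apply hP continuous_id
    (σ.continuous.comp ((adjoint σ).continuous.comp (hP x)))).add continuous_const

theorem continuous_conjugated_source {T F : ℝ → X →L[ℝ] X} (hT : ∀ x, Continuous fun s => T s x)
    (hTa : ∀ x, Continuous fun s => adjoint (T s) x) (hF : ∀ x, Continuous fun s => F s x)
    {Y : Type*} [TopologicalSpace Y] {φ ψ : Y → ℝ} (hφ : Continuous φ) (hψ : Continuous ψ) (x : X) :
    Continuous fun y => adjoint (T (φ y)) (F (ψ y) (T (φ y) x)) :=
  Continuous.strongly_apply hTa hφ (Continuous.strongly_apply hF hψ ((hT x).comp hφ))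

theorem norm_conjugated_source_le {T F : X →L[ℝ] X} {m b : ℝ} (hT : ‖T‖ ≤ m) (hF : ‖F‖ ≤ b)
    (x : X) : ‖adjoint T (F (T x))‖ ≤ m * (b * (m * ‖x‖)) :=
  (adjoint T).le_of_opNorm_le_of_le (by simpa using hT)
    (F.le_of_opNorm_le_of_le hF (T.le_of_opNorm_le hT x))

set_option maxHeartbeats 400000 in
theorem exists_isMildRiccatiSolution {T : ℝ → X →L[ℝ] X} {σ : W →L[ℝ] X} {C M : X →L[ℝ] X}
    {τ m R : ℝ} (hT0 : T 0 = 1) (hT : ∀ x, Continuous fun s => T s x)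
    (hTa : ∀ x, Continuous fun s => adjoint (T s) x) (hC : IsSelfAdjoint C) (hM : IsSelfAdjoint M)
    (hτ : 0 ≤ τ) (hR0 : 0 ≤ R) (hm : ∀ s ∈ Icc 0 τ, ‖T s‖ ≤ m)
    (hR : m * (‖M‖ * m) + τ * (m * ((R * (‖σ ∘L adjoint σ‖ * R) + ‖C‖) * m)) ≤ R)
    (hsmall : τ * (m * (‖σ ∘L adjoint σ‖ * (R + R) * m)) ≤ 1 / 2) :
    ∃ P : ℝ → X →L[ℝ] X, (∀ x, Continuous fun s => P s x) ∧ (∀ s, ‖P s‖ ≤ R) ∧ P 0 = M ∧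
      IsMildRiccatiSolution T σ C τ P := by
  have hm0 : 0 ≤ m := (norm_nonneg _).trans (hm 0 ⟨le_rfl, hτ⟩)
  set c : ℝ → ℝ := fun r => max 0 (min τ r) with hc
  have hcc : Continuous c := by fun_prop
  have hcmem : ∀ r, c r ∈ Icc 0 τ := fun r =>
    ⟨le_max_left _ _, max_le hτ (min_le_left _ _)⟩
  have hTc : ∀ r, ∀ s ∈ uIoc 0 (c r), ‖T (c r - s)‖ ≤ m := by
    intro r s hs
    rw [uIoc_of_le (hcmem r).1] at hs
    exact hm _ ⟨by linarith [hs.2], by linarith [hs.1, (hcmem r).2]⟩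
  have hint : ∀ (P : X →L[ℝ] BoundedContinuousFunction ℝ X) (x : X),
      Continuous fun p : ℝ × ℝ => adjoint (T (c p.1 - p.2))
        (riccatiTerm σ C (familyEval P p.2) (T (c p.1 - p.2) x)) := fun P x =>
    continuous_conjugated_source hT hTa
      (riccatiTerm_strongly_continuous σ C (continuous_familyEval P))
      (by fun_prop) continuous_snd x
  have hintr : ∀ (P : X →L[ℝ] BoundedContinuousFunction ℝ X) (x : X) (r : ℝ),
      IntervalIntegrable (fun s => adjoint (T (c r - s))
        (riccatiTerm σ C (familyEval P s) (T (c r - s) x))) volume 0 (c r) := fun P x r =>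
    (continuous_conjugated_source hT hTa
      (riccatiTerm_strongly_continuous σ C (continuous_familyEval P))
      (by fun_prop) continuous_id x).intervalIntegrable _ _
  have hΦ : ∀ P : X →L[ℝ] BoundedContinuousFunction ℝ X,
      ∃ Q : X →L[ℝ] BoundedContinuousFunction ℝ X, (∀ x t, Q x t =
        adjoint (T (c t)) (M (T (c t) x)) + ∫ s in (0 : ℝ)..c t, adjoint (T (c t - s))
          (riccatiTerm σ C (familyEval P s) (T (c t - s) x))) ∧
        ‖Q‖ ≤ m * (‖M‖ * m) + τ * (m * ((‖P‖ * (‖σ ∘L adjoint σ‖ * ‖P‖) + ‖C‖) * m)) := by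
    intro P
    refine exists_boundedContinuous_family (by positivity) (fun t x y => ?_) (fun t a x => ?_)
      (fun x => ?_) fun t x => ?_
    · simp only [map_add]
      rw [intervalIntegral.integral_add (hintr P x t) (hintr P y t)]
      abel
    · simp only [map_smul]
      rw [intervalIntegral.integral_smul, smul_add]
    · exact (Continuous.strongly_apply hTa hcc (M.continuous.comp ((hT x).comp hcc))).add
        (intervalIntegral.continuous_parametric_intervalIntegral_of_continuous
          (f := fun r s => adjoint (T (c r - s))
            (riccatiTerm σ C (familyEval P s) (T (c r - s) x))) (hint P x) hcc)
    · have h1 := norm_conjugated_source_le (hm _ (hcmem t)) (le_refl ‖M‖) x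
      have hF : ∀ s, ‖riccatiTerm σ C (familyEval P s)‖ ≤
          ‖P‖ * (‖σ ∘L adjoint σ‖ * ‖P‖) + ‖C‖ := fun s =>
        (norm_riccatiTerm_le σ C (familyEval P s)).trans (by
          gcongr <;> exact norm_familyEval_le P s)
      have h2 := intervalIntegral.norm_integral_le_of_norm_le_const fun s hs =>
        norm_conjugated_source_le (hTc t s hs) (hF s) x
      rw [sub_zero, abs_of_nonneg (hcmem t).1] at h2
      refine (norm_add_le _ _).trans ((add_le_add h1 (h2.trans
        (mul_le_mul_of_nonneg_left (hcmem t).2 (by positivity)))).trans_eq ?_)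
      ring
  choose Φ hΦ hΦn using hΦ
  set s : Set (X →L[ℝ] BoundedContinuousFunction ℝ X) :=
    {P | ‖P‖ ≤ R} ∩ {P | ∀ t x y, ⟪P x t, y⟫ = ⟪x, P y t⟫} with hs
  have hsclosed : IsClosed s := by
    refine (isClosed_le (continuous_norm (E := X →L[ℝ] BoundedContinuousFunction ℝ X))
      continuous_const).inter ?_
    simp only [ofPred_forall]
    refine isClosed_iInter fun t => isClosed_iInter fun x => isClosed_iInter fun y => ?_
    have hev : ∀ x, Continuous fun P : X →L[ℝ] BoundedContinuousFunction ℝ X => P x t := fun x =>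
      (BoundedContinuousFunction.evalCLM ℝ t).continuous.comp
        (ContinuousLinearMap.apply ℝ _ x).continuous
    exact isClosed_eq ((hev x).inner continuous_const) (continuous_const.inner (hev y))
  have hmaps : MapsTo Φ s s := by
    rintro P ⟨hPR, hPsa⟩
    refine ⟨(hΦn P).trans (le_trans (by gcongr <;> exact hPR) hR), fun t x y => ?_⟩
    rw [hΦ, hΦ, inner_add_left, inner_add_right, adjoint_inner_left, adjoint_inner_right]
    congr 1
    · exact hM.isSymmetric _ _
    · rw [real_inner_comm]
      have e1 := (innerSL ℝ y).intervalIntegral_comp_comm (hintr P x t)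
      have e2 := (innerSL ℝ x).intervalIntegral_comp_comm (hintr P y t)
      simp only [innerSL_apply_apply] at e1 e2
      rw [← e1, ← e2]
      refine intervalIntegral.integral_congr fun r _ => ?_
      rw [adjoint_inner_right, adjoint_inner_right, real_inner_comm,
        inner_riccatiTerm_left hC fun x y => hPsa r x y]
  have hlip : LipschitzOnWith (1 / 2) Φ s := by
    refine LipschitzOnWith.of_dist_le_mul fun P hP Q hQ => ?_
    rw [dist_eq_norm, dist_eq_norm]
    refine opNorm_le_bound _ (by positivity) fun x => ?_
    rw [BoundedContinuousFunction.norm_le (by positivity)]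
    intro t
    rw [sub_apply, BoundedContinuousFunction.sub_apply, hΦ, hΦ, add_sub_add_left_eq_sub,
      ← intervalIntegral.integral_sub (hintr P x t) (hintr Q x t)]
    simp_rw [← map_sub, ← sub_apply]
    refine (intervalIntegral.norm_integral_le_of_norm_le_const fun r hr =>
      norm_conjugated_source_le (hTc t r hr)
        ((norm_riccatiTerm_sub_le σ C _ _).trans (by
            rw [familyEval_sub]
            gcongr
            · exact (norm_familyEval_le P r).trans hP.1
            · exact (norm_familyEval_le Q r).trans hQ.1
            · exact norm_familyEval_le _ r) :
          _ ≤ ‖σ ∘L adjoint σ‖ * (R + R) * ‖P - Q‖) x).trans ?_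
    rw [sub_zero, abs_of_nonneg (hcmem t).1]
    calc m * (‖σ ∘L adjoint σ‖ * (R + R) * ‖P - Q‖ * (m * ‖x‖)) * c t
        ≤ m * (‖σ ∘L adjoint σ‖ * (R + R) * ‖P - Q‖ * (m * ‖x‖)) * τ := by
          gcongr; exact (hcmem t).2
      _ = τ * (m * (‖σ ∘L adjoint σ‖ * (R + R) * m)) * (‖P - Q‖ * ‖x‖) := by ring
      _ ≤ 1 / 2 * (‖P - Q‖ * ‖x‖) := by gcongr
      _ = _ := by push_cast; ring
  have hcontr : ContractingWith (1 / 2) (hmaps.restrict Φ s s) :=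
    ⟨by norm_num, hlip.mapsToRestrict hmaps⟩
  obtain ⟨P, ⟨hPR, hPsa⟩, hPfix, -⟩ := hcontr.exists_fixedPoint' hsclosed.isComplete hmaps
    (x := 0) ⟨opNorm_zero.le.trans hR0, by simp⟩ (edist_ne_top _ _)
  have hPeq : ∀ t ∈ Icc 0 τ, ∀ x, P x t = adjoint (T t) (M (T t x)) +
      ∫ s in (0 : ℝ)..t, adjoint (T (t - s))
        (riccatiTerm σ C (familyEval P s) (T (t - s) x)) := by
    intro t ht x
    have h := hΦ P x t
    have hct : c t = t := by simp [hc, ht.1, ht.2]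
    rwa [hPfix.eq, hct] at h
  have hP0 : familyEval P 0 = M := by
    ext x
    have h1 : adjoint (1 : X →L[ℝ] X) = 1 := star_one _
    simp [hPeq 0 ⟨le_rfl, hτ⟩ x, hT0, h1]
  refine ⟨familyEval P, continuous_familyEval P, fun t => (norm_familyEval_le P t).trans hPR, hP0,
    fun t _ => ?_, fun x => (continuous_familyEval P x).continuousOn, fun t ht x => ?_⟩
  · exact isSelfAdjoint_iff_isSymmetric.2 fun x y => hPsa t x y
  · rw [hP0]
    exact hPeq t ht x

theorem IsMildRiccatiSolution.mono {T P : ℝ → X →L[ℝ] X} {σ : W →L[ℝ] X} {C : X →L[ℝ] X}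
    {τ τ' : ℝ} (h : IsMildRiccatiSolution T σ C τ P) (hτ : τ' ≤ τ) :
    IsMildRiccatiSolution T σ C τ' P :=
  ⟨fun t ht => h.1 t (Icc_subset_Icc_right hτ ht),
    fun x => (h.2.1 x).mono (Icc_subset_Icc_right hτ),
    fun t ht x => h.2.2 t (Icc_subset_Icc_right hτ ht) x⟩

theorem IsMildRiccatiSolution.congr {T T' P P' : ℝ → X →L[ℝ] X} {σ : W →L[ℝ] X} {C : X →L[ℝ] X}
    {τ : ℝ} (h : IsMildRiccatiSolution T σ C τ P) (hTT' : ∀ t, 0 ≤ t → T' t = T t)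
    (hPP' : ∀ t ∈ Icc 0 τ, P' t = P t) : IsMildRiccatiSolution T' σ C τ P' := by
  refine ⟨fun t ht => hPP' t ht ▸ h.1 t ht,
    fun x => (h.2.1 x).congr fun t ht => by rw [hPP' t ht], fun t ht x => ?_⟩
  rw [hPP' t ht, hTT' t ht.1, h.2.2 t ht x, hPP' 0 ⟨le_rfl, ht.1.trans ht.2⟩]
  congr 1
  refine intervalIntegral.integral_congr fun s hs => ?_
  rw [uIcc_of_le ht.1] at hs
  rw [hTT' _ (sub_nonneg.2 hs.2), hPP' s ⟨hs.1, hs.2.trans ht.2⟩]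

/-- Every mild solution on `[0,τ]` extends to a strongly continuous family on the line. -/
theorem IsMildRiccatiSolution.exists_extension {T P : ℝ → X →L[ℝ] X} {σ : W →L[ℝ] X}
    {C : X →L[ℝ] X} {τ : ℝ} (h : IsMildRiccatiSolution T σ C τ P) (hτ : 0 ≤ τ) :
    ∃ Q : ℝ → X →L[ℝ] X, (∀ x, Continuous fun s => Q s x) ∧ (∀ t ∈ Icc 0 τ, Q t = P t) ∧
      IsMildRiccatiSolution T σ C τ Q := by
  have hQ : ∀ t ∈ Icc 0 τ, P (max 0 (min τ t)) = P t := fun t ht => by simp [ht.1, ht.2]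
  refine ⟨fun t => P (max 0 (min τ t)), fun x => ?_, hQ, h.congr (fun _ _ => rfl) hQ⟩
  exact (h.2.1 x).comp_continuous (by fun_prop) fun t =>
    ⟨le_max_left _ _, max_le hτ (min_le_left _ _)⟩

theorem IsMildRiccatiSolution.sub_apply_eq {T P Q : ℝ → X →L[ℝ] X} {σ : W →L[ℝ] X}
    {C : X →L[ℝ] X} {τ : ℝ} (hT : ∀ x, Continuous fun s => T s x)
    (hTa : ∀ x, Continuous fun s => adjoint (T s) x)
    (hP : IsMildRiccatiSolution T σ C τ P) (hQ : IsMildRiccatiSolution T σ C τ Q)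
    (hPc : ∀ x, Continuous fun s => P s x) (hQc : ∀ x, Continuous fun s => Q s x) {t : ℝ}
    (ht : t ∈ Icc 0 τ) (x : X) :
    (P t - Q t) x = adjoint (T t) ((P 0 - Q 0) (T t x)) + ∫ s in (0 : ℝ)..t,
      adjoint (T (t - s)) ((riccatiTerm σ C (P s) - riccatiTerm σ C (Q s)) (T (t - s) x)) := by
  have hi : ∀ {P : ℝ → X →L[ℝ] X}, (∀ x, Continuous fun s => P s x) → IntervalIntegrable
      (fun s => adjoint (T (t - s)) (riccatiTerm σ C (P s) (T (t - s) x))) volume 0 t :=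
    fun hP => (continuous_conjugated_source hT hTa (riccatiTerm_strongly_continuous σ C hP)
      (by fun_prop) continuous_id x).intervalIntegrable _ _
  simp only [sub_apply, map_sub]
  rw [intervalIntegral.integral_sub (hi hPc) (hi hQc), hP.2.2 t ht x, hQ.2.2 t ht x]
  simp only [riccatiTerm]
  abel

theorem IsMildRiccatiSolution.unique {T P Q : ℝ → X →L[ℝ] X} {σ : W →L[ℝ] X}
    {C : X →L[ℝ] X} {τ : ℝ} (hT : ∀ x, Continuous fun s => T s x)
    (hTa : ∀ x, Continuous fun s => adjoint (T s) x) (hτ : 0 ≤ τ)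
    (hP : IsMildRiccatiSolution T σ C τ P) (hQ : IsMildRiccatiSolution T σ C τ Q)
    (h0 : P 0 = Q 0) : ∀ t ∈ Icc 0 τ, P t = Q t := by
  obtain ⟨P', hPc, hPP', hP'⟩ := hP.exists_extension hτ
  obtain ⟨Q', hQc, hQQ', hQ'⟩ := hQ.exists_extension hτ
  have h0' : P' 0 - Q' 0 = 0 := by
    rw [hPP' 0 ⟨le_rfl, hτ⟩, hQQ' 0 ⟨le_rfl, hτ⟩, h0, sub_self]
  obtain ⟨m, hm0, hm⟩ := exists_norm_bound_of_strongly_continuousOn (a := 0) (b := τ)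
    fun x => (hT x).continuousOn
  obtain ⟨p, hp0, hp⟩ := exists_norm_bound_of_strongly_continuousOn (a := 0) (b := τ)
    fun x => (hPc x).continuousOn
  obtain ⟨q, hq0, hq⟩ := exists_norm_bound_of_strongly_continuousOn (a := 0) (b := τ)
    fun x => (hQc x).continuousOn
  set k := m * (‖σ ∘L adjoint σ‖ * (p + q) * m) with hk
  have hk0 : 0 ≤ k := by positivity
  have key : ∀ n : ℕ, ∀ t ∈ Icc 0 τ, ‖P' t - Q' t‖ ≤ (p + q) * ((k * t) ^ n / n.factorial) := by
    intro n
    induction n with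
    | zero =>
      intro t ht
      simpa using (norm_sub_le _ _).trans (add_le_add (hp t ht) (hq t ht))
    | succ n ih =>
      intro t ht
      have ht0 := ht.1
      refine opNorm_le_bound _ (by positivity) fun x => ?_
      rw [hP'.sub_apply_eq hT hTa hQ' hPc hQc ht, h0', zero_apply, map_zero, zero_add]
      have hbd : ∀ s ∈ Ioc 0 t, ‖adjoint (T (t - s))
          ((riccatiTerm σ C (P' s) - riccatiTerm σ C (Q' s)) (T (t - s) x))‖ ≤
          k * (p + q) * k ^ n / n.factorial * ‖x‖ * s ^ n := by
        intro s hs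
        have hs' : s ∈ Icc 0 τ := ⟨hs.1.le, hs.2.trans ht.2⟩
        refine (norm_conjugated_source_le
          (hm _ ⟨sub_nonneg.2 hs.2, by linarith [hs.1, ht.2]⟩)
          ((norm_riccatiTerm_sub_le σ C _ _).trans (mul_le_mul
            (mul_le_mul_of_nonneg_left (add_le_add (hp s hs') (hq s hs')) (norm_nonneg _))
            (ih s hs') (norm_nonneg _) (by positivity))) x).trans_eq ?_
        rw [hk, mul_pow]
        ring
      refine (intervalIntegral.norm_integral_le_of_norm_le ht0 (.of_forall hbd)
        (Continuous.intervalIntegrable (by fun_prop) _ _)).trans_eq ?_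
      rw [intervalIntegral.integral_const_mul, integral_pow, Nat.factorial_succ,
        zero_pow n.succ_ne_zero, sub_zero]
      push_cast
      field_simp
      ring_nf
  intro t ht
  have hlim : Tendsto (fun n : ℕ => (p + q) * ((k * t) ^ n / n.factorial)) atTop (𝓝 0) := by
    simpa using (FloorSemiring.tendsto_pow_div_factorial_atTop (k * t)).const_mul (p + q)
  have h := ge_of_tendsto' hlim fun n => key n t ht
  rw [← hPP' t ht, ← hQQ' t ht]
  exact sub_eq_zero.1 (norm_le_zero_iff.1 h)

/-- On a short horizon, mild Riccati solutions depend monotonically on the initial value. -/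
theorem IsMildRiccatiSolution.inner_le_of_initial {T P Q : ℝ → X →L[ℝ] X} {σ : W →L[ℝ] X}
    {C : X →L[ℝ] X} {τ m p q : ℝ} (hT0 : T 0 = 1)
    (hTadd : ∀ r s : ℝ, 0 ≤ r → 0 ≤ s → T (r + s) = T r ∘L T s)
    (hT : ∀ x, Continuous fun s => T s x) (hTa : ∀ x, Continuous fun s => adjoint (T s) x)
    (hP : IsMildRiccatiSolution T σ C τ P) (hQ : IsMildRiccatiSolution T σ C τ Q)
    (hPc : ∀ x, Continuous fun s => P s x) (hQc : ∀ x, Continuous fun s => Q s x)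
    (hm : ∀ s ∈ Icc 0 τ, ‖T s‖ ≤ m) (hp : ∀ s ∈ Icc 0 τ, ‖P s‖ ≤ p)
    (hq : ∀ s ∈ Icc 0 τ, ‖Q s‖ ≤ q)
    (hsmall : τ * (m * (‖σ ∘L adjoint σ‖ * (p + q))) ≤ 1 / 2)
    (h0 : ∀ x, 0 ≤ ⟪x, (P 0 - Q 0) x⟫) {t : ℝ} (ht : t ∈ Icc 0 τ) (x : X) :
    ⟪x, Q t x⟫ ≤ ⟪x, P t x⟫ := by
  have htτ : ∀ s ∈ Icc 0 t, s ∈ Icc 0 τ := fun s hs => ⟨hs.1, hs.2.trans ht.2⟩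
  have h00 : (0 : ℝ) ∈ Icc 0 τ := htτ 0 ⟨le_rfl, ht.1⟩
  have hm0 : 0 ≤ m := (norm_nonneg _).trans (hm 0 h00)
  have hp0 : 0 ≤ p := (norm_nonneg _).trans (hp 0 h00)
  have hq0 : 0 ≤ q := (norm_nonneg _).trans (hq 0 h00)
  set S : X →L[ℝ] X := σ ∘L adjoint σ with hS
  set K : ℝ → X →L[ℝ] X := fun s => (2⁻¹ : ℝ) • (S ∘L (P s + Q s)) with hK
  have hKc : ∀ x, Continuous fun s => K s x := fun x =>
    (S.continuous.comp ((hPc x).add (hQc x))).const_smul _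
  have hKn : ∀ s ∈ Icc 0 τ, ‖K s‖ ≤ ‖S‖ * (p + q) := by
    intro s hs
    rw [hK, norm_smul, norm_inv, Real.norm_two]
    have h1 : ‖S ∘L (P s + Q s)‖ ≤ ‖S‖ * (p + q) := (opNorm_comp_le _ _).trans
      (mul_le_mul_of_nonneg_left ((norm_add_le _ _).trans (add_le_add (hp s hs) (hq s hs)))
        (norm_nonneg _))
    have h2 : 0 ≤ ‖S ∘L (P s + Q s)‖ := norm_nonneg _
    linarith
  obtain ⟨z, hz, hzmild⟩ := exists_perturbed_trajectory (K := fun ρ => K (t - ρ)) (t := t) (m := m)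
    (k := ‖S‖ * (p + q)) hT
    (fun x => (hKc x).comp (by fun_prop)) ht.1 (fun s hs => hm s (htτ s hs))
    (fun s hs => hKn _ ⟨sub_nonneg.2 hs.2, by linarith [hs.1, ht.2]⟩)
    (le_trans (mul_le_mul_of_nonneg_right ht.2 (by positivity)) hsmall) x
  have hz0 : z 0 = x := by simp [hzmild 0 ⟨le_rfl, ht.1⟩, hT0]
  have hFK : ∀ s ∈ Icc 0 t, ∀ y,
      ⟪y, (riccatiTerm σ C (P s) - riccatiTerm σ C (Q s)) y⟫ = 2 * ⟪K s y, (P s - Q s) y⟫ := by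
    intro s hs y
    have hPs : ∀ u v, ⟪u, P s v⟫ = ⟪P s u, v⟫ := fun u v =>
      ((hP.1 s (htτ s hs)).isSymmetric u v).symm
    have hQs : ∀ u v, ⟪u, Q s v⟫ = ⟪Q s u, v⟫ := fun u v =>
      ((hQ.1 s (htτ s hs)).isSymmetric u v).symm
    have hSs : ∀ u v, ⟪S u, v⟫ = ⟪adjoint σ u, adjoint σ v⟫ := fun u v => by
      rw [adjoint_inner_right]; rfl
    have hr : ∀ Z : X →L[ℝ] X, (∀ u v, ⟪u, Z v⟫ = ⟪Z u, v⟫) →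
        ⟪y, riccatiTerm σ C Z y⟫ = ⟪adjoint σ (Z y), adjoint σ (Z y)⟫ + ⟪y, C y⟫ := by
      intro Z hZ
      rw [riccatiTerm, add_apply, inner_add_right]
      congr 1
      simp only [ContinuousLinearMap.comp_apply]
      rw [hZ, adjoint_inner_right, real_inner_comm]
    rw [sub_apply, inner_sub_right, hr _ hPs, hr _ hQs]
    simp only [hK, smul_apply, ContinuousLinearMap.comp_apply (g := S), add_apply, sub_apply,
      real_inner_smul_left, hSs, map_add, inner_add_left, inner_sub_right,
      real_inner_comm (adjoint σ (P s y)) (adjoint σ (Q s y))]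
    ring
  have hrc := fun {Z : ℝ → X →L[ℝ] X} => riccatiTerm_strongly_continuous σ C (P := Z)
  have h := inner_mild_lyapunov_eq (T := T) (D := fun s => P s - Q s)
    (F := fun s => riccatiTerm σ C (P s) - riccatiTerm σ C (Q s)) (K := K) (z := z) hT0 hTadd hT hTa
    (fun x => (hPc x).sub (hQc x)) (fun x => (hrc hPc x).sub (hrc hQc x)) hKc hz ht.1
    (fun s hs => (hP.1 s (htτ s hs)).sub (hQ.1 s (htτ s hs)))
    (fun s hs x => hP.sub_apply_eq hT hTa hQ hPc hQc (htτ s hs) x) hFK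
    (fun r hr => by rw [hz0]; exact hzmild r hr)
  have h1 := h0 (z t)
  rw [← h, hz0, sub_apply, inner_sub_right] at h1
  linarith

end Riccati

/-- If the mild Riccati solution starting from `M` stays
coercively above `M` on `(0,τ₀]`, then for every self-adjoint `M̃` with `M̃ − M`
coercive there is a horizon `τ₁ ∈ (0,τ₀]` on which a unique mild solution `P̃`
with `P̃(0) = M̃` exists, and `P̃(t) − M` is coercive for all `t ∈ (0,τ₁]`. -/
theorem riccati_solution_above_M {X W : Type*}
    [NormedAddCommGroup X] [InnerProductSpace ℝ X] [CompleteSpace X]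
    [NormedAddCommGroup W] [InnerProductSpace ℝ W] [CompleteSpace W]
    (T : ℝ → X →L[ℝ] X) (hT : IsC0Semigroup T)
    (hT' : ∀ x : X, ContinuousOn (fun t => ContinuousLinearMap.adjoint (T t) x) (Set.Ici 0))
    (σ : W →L[ℝ] X) (C : X →L[ℝ] X) (hC : IsSelfAdjoint C)
    (M : X →L[ℝ] X) (hM : IsSelfAdjoint M) (τ₀ : ℝ) (hτ₀ : 0 < τ₀)
    (P : ℝ → X →L[ℝ] X) (hP0 : P 0 = M)
    (hP : IsMildRiccatiSolution T σ C τ₀ P)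
    (hPuniq : ∀ P' : ℝ → X →L[ℝ] X, P' 0 = M → IsMildRiccatiSolution T σ C τ₀ P' →
      ∀ t ∈ Set.Icc (0:ℝ) τ₀, P' t = P t)
    (hPcoer : ∀ t ∈ Set.Ioc (0:ℝ) τ₀, Coercive (P t - M)) :
    ∀ Mt : X →L[ℝ] X, IsSelfAdjoint Mt → Coercive (Mt - M) →
      ∃ τ₁ : ℝ, τ₁ ∈ Set.Ioc (0:ℝ) τ₀ ∧
        ∃ Pt : ℝ → X →L[ℝ] X, Pt 0 = Mt ∧ IsMildRiccatiSolution T σ C τ₁ Pt ∧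
          (∀ P' : ℝ → X →L[ℝ] X, P' 0 = Mt → IsMildRiccatiSolution T σ C τ₁ P' →
            ∀ t ∈ Set.Icc (0:ℝ) τ₁, P' t = Pt t) ∧
          ∀ t ∈ Set.Ioc (0:ℝ) τ₁, Coercive (Pt t - M) := by
  obtain ⟨hT0, hTadd, hTc⟩ := hT
  intro Mt hMt hMtM
  set T' : ℝ → X →L[ℝ] X := fun t => T (max 0 t) with hT'def
  have hTT' : ∀ t, 0 ≤ t → T' t = T t := fun t ht => by simp only [hT'def, max_eq_right ht]
  have hT'0 : T' 0 = 1 := by rw [hTT' 0 le_rfl, hT0]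
  have hT'add : ∀ r s : ℝ, 0 ≤ r → 0 ≤ s → T' (r + s) = T' r ∘L T' s := fun r s hr hs => by
    rw [hTT' _ (add_nonneg hr hs), hTT' r hr, hTT' s hs, hTadd r s hr hs]
  have hT'c : ∀ x, Continuous fun t => T' t x := fun x =>
    (hTc x).comp_continuous (by fun_prop) fun t => mem_Ici.2 (le_max_left _ _)
  have hT'a : ∀ x, Continuous fun t => adjoint (T' t) x := fun x =>
    (hT' x).comp_continuous (by fun_prop : Continuous fun t : ℝ => max 0 t)
      fun t => mem_Ici.2 (le_max_left _ _)
  obtain ⟨Q, hQc, hQP, hQ⟩ :=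
    (hP.congr (T' := T') (P' := P) hTT' fun _ _ => rfl).exists_extension hτ₀.le
  obtain ⟨m, hm0, hm⟩ := exists_norm_bound_of_strongly_continuousOn (a := 0) (b := τ₀)
    fun x => (hT'c x).continuousOn
  obtain ⟨q, hq0, hq⟩ := exists_norm_bound_of_strongly_continuousOn (a := 0) (b := τ₀)
    fun x => (hQc x).continuousOn
  set S := ‖σ ∘L adjoint σ‖ with hS
  have hS0 : 0 ≤ S := norm_nonneg _
  set R := m * (‖Mt‖ * m) + 1 with hR
  have hR0 : 0 ≤ R := by positivity
  set a := m * ((R * (S * R) + ‖C‖) * m) with ha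
  set b := m * (S * (R + R) * m) with hb
  set d := m * (S * (R + q)) with hd
  have ha0 : 0 ≤ a := by positivity
  have hb0 : 0 ≤ b := by positivity
  have hd0 : 0 ≤ d := by positivity
  obtain ⟨τ, hτ, hττ₀, hτL⟩ : ∃ τ : ℝ, 0 < τ ∧ τ ≤ τ₀ ∧ τ * (a + b + d) ≤ 1 / 2 := by
    refine ⟨min τ₀ (1 / 2 / (a + b + d + 1)), by positivity, min_le_left _ _, ?_⟩
    calc min τ₀ (1 / 2 / (a + b + d + 1)) * (a + b + d)
        ≤ 1 / 2 / (a + b + d + 1) * (a + b + d + 1) :=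
          mul_le_mul (min_le_right _ _) (by linarith) (by positivity) (by positivity)
      _ = 1 / 2 := by field_simp
  have hsub : Icc 0 τ ⊆ Icc 0 τ₀ := Icc_subset_Icc_right hττ₀
  have hτa : 0 ≤ τ * a := by positivity
  have hτb : 0 ≤ τ * b := by positivity
  have hτd : 0 ≤ τ * d := by positivity
  rw [mul_add, mul_add] at hτL
  obtain ⟨Pt, hPtc, hPtR, hPt0, hPt⟩ := exists_isMildRiccatiSolution (σ := σ) (m := m) (R := R)
    hT'0 hT'c hT'a hC hMt hτ.le hR0 (fun s hs => hm s (hsub hs))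
    (show m * (‖Mt‖ * m) + τ * a ≤ R by linarith) (show τ * b ≤ 1 / 2 by linarith)
  refine ⟨τ, ⟨hτ, hττ₀⟩, Pt, hPt0, hPt.congr (fun t ht => (hTT' t ht).symm) fun _ _ => rfl,
    fun P' hP'0 hP' => ?_, fun t ht => ?_⟩
  · exact (hP'.congr hTT' fun _ _ => rfl).unique hT'c hT'a hτ.le hPt (hP'0.trans hPt0.symm)
  · obtain ⟨ε, hε, hcoer⟩ := hPcoer t ⟨ht.1, ht.2.trans hττ₀⟩
    refine ⟨ε, hε, fun x => (hcoer x).trans ?_⟩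
    have ht' : t ∈ Icc 0 τ := ⟨ht.1.le, ht.2⟩
    have hle := hPt.inner_le_of_initial hT'0 hT'add hT'c hT'a (hQ.mono hττ₀) hPtc hQc
      (fun s hs => hm s (hsub hs)) (fun s _ => hPtR s) (fun s hs => hq s (hsub hs))
      (show τ * d ≤ 1 / 2 by linarith) (fun y => ?_) ht' x
    · rw [hQP t (hsub ht')] at hle
      simp only [sub_apply, inner_sub_right]
      linarith
    · obtain ⟨δ, hδ, hpos⟩ := hMtM
      rw [hPt0, hQP 0 ⟨le_rfl, hτ₀.le⟩, hP0]
      exact le_trans (by positivity) (hpos y)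
end

section
/- Let X and W be real Hilbert spaces, T a C0-semigroup on X whose adjoint family is strongly continuous, σ ∈ B(W,X), and C ∈ B(X) self-adjoint. Let M ∈ Σ(X), τ > 0, and let P be a mild solution of the operator differential Riccati equation on [0,τ] with P(0) = M. Then there exists τ₂ ∈ (0,τ] such that: (i) there is a unique strongly continuous map Q : [0,τ₂] → B(X) with Q(0) = −M satisfying Q(t)x = (T t)'(−M)x + ∫₀ᵗ (T(t−s))' [P(s) σ σ' Q(s)] x ds for all t ∈ [0,τ₂] and x ∈ X; and (ii) there is a unique strongly continuous map R : [0,τ₂] → Σ(X) with R(0) = M satisfying R(t)x = M x + ∫₀ᵗ Q(s)' σ σ' Q(s) x ds for all t ∈ [0,τ₂] and x ∈ X. -/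
open RealInnerProductSpace MeasureTheory

/-- Mild solution of the auxiliary equation `Q̇ = A'Q + P σ σ' Q`, `Q(0) = −M`. -/
def IsMildQSolution {X W : Type*}
    [NormedAddCommGroup X] [InnerProductSpace ℝ X] [CompleteSpace X]
    [NormedAddCommGroup W] [InnerProductSpace ℝ W] [CompleteSpace W]
    (T : ℝ → X →L[ℝ] X) (σ : W →L[ℝ] X) (M : X →L[ℝ] X) (P : ℝ → X →L[ℝ] X)
    (τ : ℝ) (Q : ℝ → X →L[ℝ] X) : Prop :=
  Q 0 = -M ∧
  (∀ x : X, ContinuousOn (fun t => Q t x) (Set.Icc (0:ℝ) τ)) ∧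
  ∀ t ∈ Set.Icc (0:ℝ) τ, ∀ x : X,
    Q t x = ContinuousLinearMap.adjoint (T t) ((-M) x) +
      ∫ s in (0:ℝ)..t, ContinuousLinearMap.adjoint (T (t - s))
        ((P s ∘L σ ∘L ContinuousLinearMap.adjoint σ ∘L Q s) x)

/-- Mild solution of the auxiliary equation `Ṙ = Q' σ σ' Q`, `R(0) = M`. -/
def IsMildRSolution {X W : Type*}
    [NormedAddCommGroup X] [InnerProductSpace ℝ X] [CompleteSpace X]
    [NormedAddCommGroup W] [InnerProductSpace ℝ W] [CompleteSpace W]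
    (σ : W →L[ℝ] X) (M : X →L[ℝ] X) (Q : ℝ → X →L[ℝ] X)
    (τ : ℝ) (R : ℝ → X →L[ℝ] X) : Prop :=
  R 0 = M ∧
  (∀ t ∈ Set.Icc (0:ℝ) τ, IsSelfAdjoint (R t)) ∧
  (∀ x : X, ContinuousOn (fun t => R t x) (Set.Icc (0:ℝ) τ)) ∧
  ∀ t ∈ Set.Icc (0:ℝ) τ, ∀ x : X,
    R t x = M x +
      ∫ s in (0:ℝ)..t,
        (ContinuousLinearMap.adjoint (Q s) ∘L σ ∘L ContinuousLinearMap.adjoint σ ∘L Q s) x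

open ContinuousLinearMap (adjoint)

section StrongContinuity

variable {X : Type*} [NormedAddCommGroup X] [InnerProductSpace ℝ X]

/-- Strong continuity and uniform boundedness give joint continuity. -/
theorem continuous_apply_of_norm_le {α : Type*} [TopologicalSpace α] {K : α → X →L[ℝ] X} {c : ℝ}
    (hc : ∀ a, ‖K a‖ ≤ c) (hK : ∀ x, Continuous fun a => K a x) {g : α → X} (hg : Continuous g) :
    Continuous fun a => K a (g a) := by
  rw [continuous_iff_continuousAt]
  intro a₀
  have h₁ : Filter.Tendsto (fun a => K a (g a - g a₀)) (nhds a₀) (nhds 0) := by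
    refine squeeze_zero_norm (a := fun a => c * ‖g a - g a₀‖)
      (fun a => (K a).le_of_opNorm_le (hc a) _) ?_
    have : Continuous fun a => c * ‖g a - g a₀‖ := by fun_prop
    simpa using this.tendsto a₀
  have h₂ := h₁.add ((hK (g a₀)).tendsto a₀)
  simpa [ContinuousAt] using h₂

variable [CompleteSpace X]

/-- A uniformly bounded operator-valued map which, together with its pointwise adjoint, is
continuous in the strong operator topology. -/
structure IsBoundedStrongStar {α : Type*} [TopologicalSpace α] (K : α → X →L[ℝ] X) (c : ℝ) :
    Prop where
  norm_le : ∀ a, ‖K a‖ ≤ c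
  continuous_apply : ∀ x, Continuous fun a => K a x
  continuous_adjoint_apply : ∀ x, Continuous fun a => adjoint (K a) x

namespace IsBoundedStrongStar

variable {α β : Type*} [TopologicalSpace α] [TopologicalSpace β] {K L : α → X →L[ℝ] X} {c d : ℝ}

theorem adjoint (hK : IsBoundedStrongStar K c) :
    IsBoundedStrongStar (fun a => ContinuousLinearMap.adjoint (K a)) c where
  norm_le a := by simpa using hK.norm_le a
  continuous_apply := hK.continuous_adjoint_apply
  continuous_adjoint_apply := by simpa using hK.continuous_apply

theorem comp (hK : IsBoundedStrongStar K c) (hL : IsBoundedStrongStar L d) :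
    IsBoundedStrongStar (fun a => K a ∘L L a) (c * d) where
  norm_le a := (ContinuousLinearMap.opNorm_comp_le _ _).trans <|
    mul_le_mul (hK.norm_le a) (hL.norm_le a) (norm_nonneg _) ((norm_nonneg _).trans (hK.norm_le a))
  continuous_apply x :=
    continuous_apply_of_norm_le hK.norm_le hK.continuous_apply (hL.continuous_apply x)
  continuous_adjoint_apply x := by
    simpa [ContinuousLinearMap.adjoint_comp] using
      continuous_apply_of_norm_le hL.adjoint.norm_le hL.continuous_adjoint_apply
        (hK.continuous_adjoint_apply x)

theorem add (hK : IsBoundedStrongStar K c) (hL : IsBoundedStrongStar L d) :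
    IsBoundedStrongStar (fun a => K a + L a) (c + d) where
  norm_le a := (norm_add_le _ _).trans (add_le_add (hK.norm_le a) (hL.norm_le a))
  continuous_apply x := (hK.continuous_apply x).add (hL.continuous_apply x)
  continuous_adjoint_apply x := by
    simp only [map_add, add_apply]
    exact (hK.continuous_adjoint_apply x).add (hL.continuous_adjoint_apply x)

theorem const (A : X →L[ℝ] X) : IsBoundedStrongStar (fun _ : α => A) ‖A‖ :=
  ⟨fun _ => le_rfl, fun _ => continuous_const, fun _ => continuous_const⟩

theorem comp_continuous (hK : IsBoundedStrongStar K c) {u : β → α} (hu : Continuous u) :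
    IsBoundedStrongStar (fun b => K (u b)) c :=
  ⟨fun b => hK.norm_le (u b), fun x => (hK.continuous_apply x).comp hu,
    fun x => (hK.continuous_adjoint_apply x).comp hu⟩

/-- The strong integral of a family of operators over a continuously varying interval. -/
theorem exists_integral {k : ℝ × ℝ → X →L[ℝ] X} (hk : IsBoundedStrongStar k c) {p : ℝ → ℝ}
    (hp : Continuous p) {b : ℝ} (hp₀ : ∀ t, 0 ≤ p t) (hpb : ∀ t, p t ≤ b) :
    ∃ J : ℝ → X →L[ℝ] X, IsBoundedStrongStar J (c * b) ∧
      (∀ t x, J t x = ∫ s in (0:ℝ)..p t, k (t, s) x) ∧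
      ∀ t x, ContinuousLinearMap.adjoint (J t) x =
        ∫ s in (0:ℝ)..p t, ContinuousLinearMap.adjoint (k (t, s)) x := by
  have hc : 0 ≤ c := (norm_nonneg _).trans (hk.norm_le 0)
  have int₁ : ∀ t x e, IntervalIntegrable (fun s => k (t, s) x) volume 0 e := fun t x e =>
    ((hk.continuous_apply x).comp (by fun_prop : Continuous fun s : ℝ => (t, s))
      ).intervalIntegrable _ _
  have int₂ : ∀ t x e, IntervalIntegrable
      (fun s => ContinuousLinearMap.adjoint (k (t, s)) x) volume 0 e := fun t x e =>
    ((hk.continuous_adjoint_apply x).comp (by fun_prop : Continuous fun s : ℝ => (t, s))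
      ).intervalIntegrable _ _
  have bound : ∀ t x, ‖∫ s in (0:ℝ)..p t, k (t, s) x‖ ≤ c * b * ‖x‖ := by
    intro t x
    refine (intervalIntegral.norm_integral_le_of_norm_le_const (C := c * ‖x‖)
      fun s _ => (k (t, s)).le_of_opNorm_le (hk.norm_le _) x).trans ?_
    rw [sub_zero, abs_of_nonneg (hp₀ t)]
    have := mul_le_mul_of_nonneg_left (hpb t) (mul_nonneg hc (norm_nonneg x))
    linarith
  let J : ℝ → X →L[ℝ] X := fun t => LinearMap.mkContinuous
    { toFun := fun x => ∫ s in (0:ℝ)..p t, k (t, s) x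
      map_add' := fun x y => by
        simp only [map_add]
        exact intervalIntegral.integral_add (int₁ t x _) (int₁ t y _)
      map_smul' := fun r x => by
        simp only [map_smul, RingHom.id_apply]
        exact intervalIntegral.integral_smul r _ } (c * b) (bound t)
  have hJ : ∀ t x, J t x = ∫ s in (0:ℝ)..p t, k (t, s) x := fun _ _ => rfl
  have hJ' : ∀ t x, ContinuousLinearMap.adjoint (J t) x =
      ∫ s in (0:ℝ)..p t, ContinuousLinearMap.adjoint (k (t, s)) x := by
    intro t x
    refine ext_inner_left ℝ fun y => ?_
    rw [ContinuousLinearMap.adjoint_inner_right, hJ, real_inner_comm]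
    have h₁ := (innerSL ℝ x).intervalIntegral_comp_comm (int₁ t y (p t))
    have h₂ := (innerSL ℝ y).intervalIntegral_comp_comm (int₂ t x (p t))
    simp only [innerSL_apply_apply] at h₁ h₂
    rw [← h₁, ← h₂]
    refine intervalIntegral.integral_congr fun s _ => ?_
    simp only [ContinuousLinearMap.adjoint_inner_right]
    exact real_inner_comm _ _
  refine ⟨J, ⟨fun t => LinearMap.mkContinuous_norm_le _
    (mul_nonneg hc ((hp₀ 0).trans (hpb 0))) _, fun x => ?_, fun x => ?_⟩, hJ, hJ'⟩
  · simp only [hJ]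
    exact intervalIntegral.continuous_parametric_intervalIntegral_of_continuous
      (f := fun t s => k (t, s) x) (hk.continuous_apply x) hp
  · simp only [hJ']
    exact intervalIntegral.continuous_parametric_intervalIntegral_of_continuous
      (f := fun t s => ContinuousLinearMap.adjoint (k (t, s)) x) (hk.continuous_adjoint_apply x) hp

end IsBoundedStrongStar

/-- Strongly continuous maps on a compact interval, with strongly continuous adjoint, extend to the
line as uniformly bounded ones. -/
theorem exists_isBoundedStrongStar_projIcc {K : ℝ → X →L[ℝ] X} {b : ℝ} (hb : 0 ≤ b)
    (hK : ∀ x, ContinuousOn (fun t => K t x) (Set.Icc 0 b))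
    (hK' : ∀ x, ContinuousOn (fun t => adjoint (K t) x) (Set.Icc 0 b)) :
    ∃ c, IsBoundedStrongStar (fun t => K (Set.projIcc 0 b hb t)) c := by
  have cont : ∀ {g : ℝ → X}, ContinuousOn g (Set.Icc 0 b) →
      Continuous fun t => g (Set.projIcc 0 b hb t) := fun hg =>
    hg.comp_continuous (by fun_prop) fun t => (Set.projIcc 0 b hb t).2
  obtain ⟨c, hc⟩ := banach_steinhaus (g := fun s : Set.Icc (0:ℝ) b => K s) fun x => by
    obtain ⟨c, hc⟩ := isCompact_Icc.exists_bound_of_continuousOn (hK x)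
    exact ⟨c, fun s => hc s s.2⟩
  exact ⟨c, fun t => hc _, fun x => cont (hK x), fun x => cont (hK' x)⟩

/-- The operator-valued linear Volterra equation has a solution on a short interval. -/
theorem exists_volterra_solution {F : ℝ → X →L[ℝ] X} {S G : ℝ → X →L[ℝ] X} {e c d b : ℝ}
    (hF : IsBoundedStrongStar F e) (hS : IsBoundedStrongStar S c) (hG : IsBoundedStrongStar G d)
    (hb : 0 ≤ b) (hbcd : c * d * b ≤ 1 / 2) :
    ∃ Q : ℝ → X →L[ℝ] X, (∃ q, IsBoundedStrongStar Q q) ∧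
      ∀ t ∈ Set.Icc 0 b, ∀ x, Q t x = F t x + ∫ s in (0:ℝ)..t, S (t - s) (G s (Q s x)) := by
  let p : ℝ → ℝ := fun t => Set.projIcc 0 b hb t
  have hp : Continuous p := by fun_prop
  have hp₀ : ∀ t, 0 ≤ p t := fun t => (Set.projIcc 0 b hb t).2.1
  have hpb : ∀ t, p t ≤ b := fun t => (Set.projIcc 0 b hb t).2.2
  have hcd : 0 ≤ c * d :=
    mul_nonneg ((norm_nonneg _).trans (hS.norm_le 0)) ((norm_nonneg _).trans (hG.norm_le 0))
  have hkern : ∀ {f : ℝ → X →L[ℝ] X} {r : ℝ}, IsBoundedStrongStar f r →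
      IsBoundedStrongStar (fun z : ℝ × ℝ => (S (p z.1 - z.2) ∘L G z.2) ∘L f z.2) (c * d * r) :=
    fun hf => ((hS.comp_continuous (by fun_prop)).comp (hG.comp_continuous continuous_snd)).comp
      (hf.comp_continuous continuous_snd)
  let E := lp (fun _ : ℝ => X →L[ℝ] X) ⊤
  let A : Set E := {f | (∀ x, Continuous fun t => f t x) ∧
    ∀ x, Continuous fun t => adjoint (f t) x}
  have hA : IsClosed A := by
    refine isClosed_of_closure_subset fun f hf => ?_
    have approx : ∀ ε > 0, ∃ g ∈ A, ∀ t, ‖f t - g t‖ < ε := fun ε hε => by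
      obtain ⟨g, hg, hfg⟩ := Metric.mem_closure_iff.1 hf ε hε
      refine ⟨g, hg, fun t => lt_of_le_of_lt ?_ hfg⟩
      rw [dist_eq_norm]
      exact lp.norm_apply_le_norm ENNReal.top_ne_zero (f - g) t
    constructor <;> intro x <;> refine continuous_of_uniform_approx_of_continuous fun u hu => ?_ <;>
      obtain ⟨ε, hε, hu⟩ := Metric.mem_uniformity_dist.1 hu <;>
      obtain ⟨g, hg, hfg⟩ := approx (ε / (‖x‖ + 1)) (by positivity)
    · refine ⟨_, hg.1 x, fun t => hu ?_⟩
      rw [dist_eq_norm, ← sub_apply]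
      refine ((f t - g t).le_opNorm x).trans_lt ?_
      have := (lt_div_iff₀ (by positivity)).1 (hfg t)
      nlinarith [norm_nonneg (f t - g t)]
    · refine ⟨_, hg.2 x, fun t => hu ?_⟩
      rw [dist_eq_norm, ← sub_apply, ← map_sub]
      refine ((adjoint (f t - g t)).le_opNorm x).trans_lt ?_
      rw [LinearIsometryEquiv.norm_map]
      have := (lt_div_iff₀ (by positivity)).1 (hfg t)
      nlinarith [norm_nonneg (f t - g t)]
  have hbs : ∀ f : A, IsBoundedStrongStar (fun t => (f : E) t) ‖(f : E)‖ := fun f =>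
    ⟨fun t => lp.norm_apply_le_norm ENNReal.top_ne_zero f.1 t, f.2.1, f.2.2⟩
  have picard : ∀ f : A, ∃ g : A, ∀ t x, (g : E) t x =
      F t x + ∫ s in (0:ℝ)..p t, S (p t - s) (G s ((f : E) s x)) := fun f => by
    obtain ⟨J, hJ, hJx, -⟩ := (hkern (hbs f)).exists_integral hp hp₀ hpb
    have hg := hF.add hJ
    refine ⟨⟨⟨fun t => F t + J t, ?_⟩, hg.continuous_apply, hg.continuous_adjoint_apply⟩, ?_⟩
    · refine memℓp_infty ⟨e + c * d * ‖(f : E)‖ * b, ?_⟩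
      rintro _ ⟨t, rfl⟩
      exact hg.norm_le t
    · intro t x
      change (F t + J t) x = _
      rw [add_apply, hJx]
      rfl
  choose Φ hΦ using picard
  have hcontr : ContractingWith (1 / 2) Φ := by
    refine ⟨by norm_num [← NNReal.coe_lt_coe], LipschitzWith.of_dist_le_mul fun f g => ?_⟩
    rw [Subtype.dist_eq, Subtype.dist_eq, dist_eq_norm, dist_eq_norm]
    refine lp.norm_le_of_forall_le (by positivity) fun t => ?_
    refine ContinuousLinearMap.opNorm_le_bound _ (by positivity) fun x => ?_
    have hint : ∀ h : A, IntervalIntegrable (fun s => S (p t - s) (G s ((h : E) s x)))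
        volume 0 (p t) := fun h =>
      (((hkern (hbs h)).continuous_apply x).comp
        (by fun_prop : Continuous fun s : ℝ => (t, s))).intervalIntegrable _ _
    have hsub : ((Φ f : E) - (Φ g : E)) t x =
        ∫ s in (0:ℝ)..p t, S (p t - s) (G s (((f : E) - (g : E)) s x)) := by
      change (Φ f : E) t x - (Φ g : E) t x = _
      rw [hΦ, hΦ, add_sub_add_left_eq_sub, ← intervalIntegral.integral_sub (hint f) (hint g)]
      refine intervalIntegral.integral_congr fun s _ => ?_
      simp
    rw [hsub]
    refine (intervalIntegral.norm_integral_le_of_norm_le_const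
      (C := c * d * (‖(f : E) - (g : E)‖ * ‖x‖)) fun s _ => ?_).trans ?_
    · rw [mul_assoc]
      refine (S _).le_of_opNorm_le_of_le (hS.norm_le _) ?_
      refine (G _).le_of_opNorm_le_of_le (hG.norm_le _) ?_
      exact ContinuousLinearMap.le_of_opNorm_le _
        (lp.norm_apply_le_norm ENNReal.top_ne_zero ((f : E) - (g : E)) s) x
    · rw [sub_zero, abs_of_nonneg (hp₀ t)]
      have h₁ : c * d * p t ≤ 1 / 2 :=
        (mul_le_mul_of_nonneg_left (hpb t) hcd).trans hbcd
      have h₂ := mul_le_mul_of_nonneg_right h₁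
        (mul_nonneg (norm_nonneg ((f : E) - (g : E))) (norm_nonneg x))
      push_cast
      linarith
  have : CompleteSpace A := hA.completeSpace_coe
  have : Nonempty A := ⟨⟨0, by constructor <;> intro x <;> simpa using continuous_const⟩⟩
  let Q := hcontr.fixedPoint
  have hQ : Φ Q = Q := hcontr.fixedPoint_isFixedPt
  refine ⟨fun t => (Q : E) t, ⟨_, hbs Q⟩, fun t ht x => ?_⟩
  have := hΦ Q t x
  rw [hQ] at this
  have hpt : p t = t := by simp [p, Set.projIcc_of_mem hb ht]
  rwa [hpt] at this

/-- A continuous function on a compact interval vanishes if every uniform bound for it can be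
halved. -/
theorem eq_zero_of_norm_le_half {V : Type*} [NormedAddCommGroup V] {u : ℝ → V} {b : ℝ}
    (hb : 0 ≤ b) (hu : ContinuousOn u (Set.Icc 0 b))
    (h : ∀ m, (∀ s ∈ Set.Icc 0 b, ‖u s‖ ≤ m) → ∀ t ∈ Set.Icc 0 b, ‖u t‖ ≤ m / 2) :
    ∀ t ∈ Set.Icc 0 b, u t = 0 := by
  obtain ⟨t₀, ht₀, hmax⟩ :=
    isCompact_Icc.exists_isMaxOn (Set.nonempty_Icc.2 hb) hu.norm
  have hle : ∀ s ∈ Set.Icc 0 b, ‖u s‖ ≤ ‖u t₀‖ := fun s hs => hmax hs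
  have h₀ := h _ hle t₀ ht₀
  intro t ht
  have := hle t ht
  exact norm_le_zero_iff.1 (by linarith)

/-- Uniqueness of strongly continuous solutions of the linear Volterra equation on a short
interval. -/
theorem volterra_solution_unique {F S G Q Q' : ℝ → X →L[ℝ] X} {c d b : ℝ}
    (hS : IsBoundedStrongStar S c) (hG : IsBoundedStrongStar G d)
    (hb : 0 ≤ b) (hbcd : c * d * b ≤ 1 / 2)
    (hQ : ∀ x, ContinuousOn (fun t => Q t x) (Set.Icc 0 b))
    (hQ' : ∀ x, ContinuousOn (fun t => Q' t x) (Set.Icc 0 b))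
    (eQ : ∀ t ∈ Set.Icc 0 b, ∀ x, Q t x = F t x + ∫ s in (0:ℝ)..t, S (t - s) (G s (Q s x)))
    (eQ' : ∀ t ∈ Set.Icc 0 b, ∀ x,
      Q' t x = F t x + ∫ s in (0:ℝ)..t, S (t - s) (G s (Q' s x))) :
    ∀ t ∈ Set.Icc 0 b, Q' t = Q t := by
  intro t ht
  ext x
  refine sub_eq_zero.1 (eq_zero_of_norm_le_half (u := fun t => Q' t x - Q t x) hb
    ((hQ' x).sub (hQ x)) (fun m hm t ht => ?_) t ht)
  have hint : ∀ {v : ℝ → X}, ContinuousOn v (Set.Icc 0 b) →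
      IntervalIntegrable (fun s => S (t - s) (G s (v s))) volume 0 t := fun {v} hv => by
    have hv' : Continuous fun s => v (Set.projIcc 0 b hb s) :=
      hv.comp_continuous (by fun_prop) fun s => (Set.projIcc 0 b hb s).2
    have hk : Continuous fun s => S (t - s) (G s (v (Set.projIcc 0 b hb s))) :=
      continuous_apply_of_norm_le (K := fun s => S (t - s)) (fun s => hS.norm_le _)
        (fun x => (hS.continuous_apply x).comp (by fun_prop))
        (continuous_apply_of_norm_le hG.norm_le hG.continuous_apply hv')
    refine (hk.intervalIntegrable 0 t).congr fun s hs => ?_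
    rw [Set.uIoc_of_le ht.1] at hs
    have hs' : s ∈ Set.Icc 0 b := ⟨hs.1.le, hs.2.trans ht.2⟩
    simp [Set.projIcc_of_mem hb hs']
  have hm₀ : 0 ≤ m := (norm_nonneg _).trans (hm t ht)
  have hc : 0 ≤ c := (norm_nonneg _).trans (hS.norm_le 0)
  have hd : 0 ≤ d := (norm_nonneg _).trans (hG.norm_le 0)
  have hsub : Q' t x - Q t x = ∫ s in (0:ℝ)..t, S (t - s) (G s (Q' s x - Q s x)) := by
    rw [eQ t ht, eQ' t ht, add_sub_add_left_eq_sub,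
      ← intervalIntegral.integral_sub (hint (hQ' x)) (hint (hQ x))]
    simp
  change ‖Q' t x - Q t x‖ ≤ _
  rw [hsub]
  refine (intervalIntegral.norm_integral_le_of_norm_le_const (C := c * (d * m))
    fun s hs => ?_).trans ?_
  · rw [Set.uIoc_of_le ht.1] at hs
    exact (S _).le_of_opNorm_le_of_le (hS.norm_le _)
      ((G _).le_of_opNorm_le_of_le (hG.norm_le _) (hm s ⟨hs.1.le, hs.2.trans ht.2⟩))
  · rw [sub_zero, abs_of_nonneg ht.1]
    have h₁ := mul_le_mul_of_nonneg_left ht.2 (mul_nonneg hc hd)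
    have h₂ := mul_le_mul_of_nonneg_right (h₁.trans hbcd) hm₀
    linarith

end StrongContinuity

/-- Existence and uniqueness of the auxiliary operator
differential equation solutions `Q` and `R` on a common sub-horizon. -/
theorem auxiliary_equations_existence_uniqueness {X W : Type*}
    [NormedAddCommGroup X] [InnerProductSpace ℝ X] [CompleteSpace X]
    [NormedAddCommGroup W] [InnerProductSpace ℝ W] [CompleteSpace W]
    (T : ℝ → X →L[ℝ] X) (hT : IsC0Semigroup T)
    (hT' : ∀ x : X, ContinuousOn (fun t => ContinuousLinearMap.adjoint (T t) x) (Set.Ici 0))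
    (σ : W →L[ℝ] X) (C : X →L[ℝ] X) (hC : IsSelfAdjoint C)
    (M : X →L[ℝ] X) (hM : IsSelfAdjoint M) (τ : ℝ) (hτ : 0 < τ)
    (P : ℝ → X →L[ℝ] X) (hP0 : P 0 = M) (hP : IsMildRiccatiSolution T σ C τ P) :
    ∃ τ₂ : ℝ, τ₂ ∈ Set.Ioc (0:ℝ) τ ∧
      (∃ Q : ℝ → X →L[ℝ] X, IsMildQSolution T σ M P τ₂ Q ∧
        ∀ Q' : ℝ → X →L[ℝ] X, IsMildQSolution T σ M P τ₂ Q' →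
          ∀ t ∈ Set.Icc (0:ℝ) τ₂, Q' t = Q t) ∧
      ∀ Q : ℝ → X →L[ℝ] X, IsMildQSolution T σ M P τ₂ Q →
        ∃ R : ℝ → X →L[ℝ] X, IsMildRSolution σ M Q τ₂ R ∧
          ∀ R' : ℝ → X →L[ℝ] X, IsMildRSolution σ M Q τ₂ R' →
            ∀ t ∈ Set.Icc (0:ℝ) τ₂, R' t = R t := by
  obtain ⟨hPsa, hPc, -⟩ := hP
  have hτ₀ : (0:ℝ) ≤ τ := hτ.le
  have hsub : Set.Icc (0:ℝ) τ ⊆ Set.Ici 0 := fun t ht => ht.1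
  obtain ⟨c, hS⟩ := exists_isBoundedStrongStar_projIcc (K := fun t => adjoint (T t)) hτ₀
    (fun x => (hT' x).mono hsub) (fun x => by simpa using (hT.2.2 x).mono hsub)
  obtain ⟨d₀, hP'⟩ := exists_isBoundedStrongStar_projIcc hτ₀ hPc
    (fun x => (hPc x).congr fun t ht => by
      rw [ContinuousLinearMap.isSelfAdjoint_iff'.1 (hPsa t ht)])
  set D : X →L[ℝ] X := σ ∘L adjoint σ with hD
  have hG := hP'.comp (IsBoundedStrongStar.const D)
  have hF := hS.comp (IsBoundedStrongStar.const (-M))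
  set d := d₀ * ‖D‖
  have hcd : 0 ≤ c * d :=
    mul_nonneg ((norm_nonneg _).trans (hS.norm_le 0)) ((norm_nonneg _).trans (hG.norm_le 0))
  obtain ⟨b, hb₀, hbτ, hbcd⟩ : ∃ b, 0 < b ∧ b ≤ τ ∧ c * d * b ≤ 1 / 2 := by
    refine ⟨min τ (1 / (2 * (c * d + 1))), by positivity, min_le_left _ _, ?_⟩
    refine (mul_le_mul_of_nonneg_left (min_le_right _ _) hcd).trans ?_
    rw [mul_one_div, div_le_div_iff₀ (by positivity) (by norm_num)]
    linarith
  have volterra_of_mild : ∀ {Q : ℝ → X →L[ℝ] X}, ∀ t ∈ Set.Icc (0:ℝ) b, ∀ x : X,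
      adjoint (T t) ((-M) x) + ∫ s in (0:ℝ)..t, adjoint (T (t - s))
        ((P s ∘L σ ∘L adjoint σ ∘L Q s) x) =
      (adjoint (T (Set.projIcc 0 τ hτ₀ t)) ∘L (-M)) x +
        ∫ s in (0:ℝ)..t, adjoint (T (Set.projIcc 0 τ hτ₀ (t - s)))
          ((P (Set.projIcc 0 τ hτ₀ s) ∘L D) (Q s x)) := by
    intro Q t ht x
    have hproj : ∀ {r : ℝ}, 0 ≤ r → r ≤ t → (Set.projIcc 0 τ hτ₀ r : ℝ) = r := fun h₀ h₁ => by
      rw [Set.projIcc_of_mem hτ₀ ⟨h₀, h₁.trans (ht.2.trans hbτ)⟩]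
    rw [hproj ht.1 le_rfl]
    congr 1
    refine intervalIntegral.integral_congr fun s hs => ?_
    rw [Set.uIcc_of_le ht.1] at hs
    rw [hproj hs.1 hs.2, hproj (sub_nonneg.2 hs.2) (by linarith [hs.1])]
    rfl
  obtain ⟨Q₀, ⟨q, hQ₀⟩, eQ₀⟩ := exists_volterra_solution hF hS hG hb₀.le hbcd
  have unique : ∀ Q : ℝ → X →L[ℝ] X, IsMildQSolution T σ M P b Q →
      ∀ t ∈ Set.Icc 0 b, Q t = Q₀ t := fun Q hQ =>
    volterra_solution_unique hS hG hb₀.le hbcd (fun x => (hQ₀.continuous_apply x).continuousOn)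
      hQ.2.1 eQ₀ fun t ht x => (hQ.2.2 t ht x).trans (volterra_of_mild t ht x)
  refine ⟨b, ⟨hb₀, hbτ⟩, ⟨Q₀, ⟨?_, fun x => (hQ₀.continuous_apply x).continuousOn,
    fun t ht x => (eQ₀ t ht x).trans (volterra_of_mild t ht x).symm⟩, unique⟩, fun Q hQ => ?_⟩
  · ext x
    rw [eQ₀ 0 ⟨le_rfl, hb₀.le⟩ x, ← volterra_of_mild 0 ⟨le_rfl, hb₀.le⟩ x]
    simp [hT.1, show adjoint (1 : X →L[ℝ] X) = 1 from star_one _]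
  · have hk := (hQ₀.adjoint.comp (IsBoundedStrongStar.const D)).comp hQ₀
    have hproj : ∀ {t : ℝ}, t ∈ Set.Icc 0 b → (Set.projIcc 0 b hb₀.le t : ℝ) = t := fun ht => by
      rw [Set.projIcc_of_mem hb₀.le ht]
    obtain ⟨J, hJ, hJx, hJx'⟩ := (hk.comp_continuous (u := Prod.snd (α := ℝ))
      continuous_snd).exists_integral (p := fun t => Set.projIcc 0 b hb₀.le t) (by fun_prop)
      (fun t => (Set.projIcc 0 b hb₀.le t).2.1) (fun t => (Set.projIcc 0 b hb₀.le t).2.2)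
    have hDsa : adjoint D = D := by simp [hD, ContinuousLinearMap.adjoint_comp]
    have eR : ∀ t ∈ Set.Icc 0 b, ∀ x, J t x = ∫ s in (0:ℝ)..t,
        (adjoint (Q s) ∘L σ ∘L adjoint σ ∘L Q s) x := by
      intro t ht x
      rw [hJx, hproj ht]
      refine intervalIntegral.integral_congr fun s hs => ?_
      rw [Set.uIcc_of_le ht.1] at hs
      simp only
      rw [unique Q hQ s ⟨hs.1, hs.2.trans ht.2⟩]
      rfl
    refine ⟨fun t => M + J t, ⟨?_, fun t ht => hM.add ?_,
      fun x => (continuous_const.add (hJ.continuous_apply x)).continuousOn, fun t ht x => ?_⟩,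
      fun R' hR' t ht => ?_⟩
    · ext x
      simp [hJx]
    · rw [ContinuousLinearMap.isSelfAdjoint_iff']
      ext x
      rw [hJx, hJx']
      simp [ContinuousLinearMap.adjoint_comp, hDsa]
    · rw [add_apply, eR t ht]
    · ext x
      rw [hR'.2.2.2 t ht x, add_apply, eR t ht]
end

section
/- Let X be a real Hilbert space, M, P, R ∈ Σ(X) and Q ∈ B(X), and suppose P − M is coercive (hence boundedly invertible). Define B11 = −M − M (P − M)⁻¹ M, B12 = −Q' (P − M)⁻¹ M, and B22 = −Q' (P − M)⁻¹ Q + R. Then B11, B22 ∈ Σ(X), and for all y, z ∈ X: − sup_{x ∈ X} [ ½⟨x − y, M(x − y)⟩ − ½⟨x, P x⟩ − ⟨x, Q z⟩ − ½⟨z, R z⟩ ] = ½⟨y, B11 y⟩ + ⟨z, B12 y⟩ + ½⟨z, B22 z⟩, the supremum being finite and attained at x* = −(P − M)⁻¹(M y + Q z). -/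
open RealInnerProductSpace

/-- A coercive bounded operator on a real Hilbert space is a unit. -/
theorem Coercive.isUnit {X : Type*} [NormedAddCommGroup X] [InnerProductSpace ℝ X]
    [CompleteSpace X] {F : X →L[ℝ] X} (hF : Coercive F) : IsUnit F := by
  obtain ⟨ε, hε, h⟩ := hF
  refine ContinuousLinearMap.isUnit_of_forall_le_norm_inner_map F (c := ⟨ε, hε.le⟩) hε fun x => ?_
  rw [real_inner_comm, Real.norm_eq_abs]
  exact (mul_comm _ _).trans_le ((h x).trans (le_abs_self _))

/-- Inner products of a vector against the image of a self-adjoint operator are symmetric. -/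
theorem IsSelfAdjoint.inner_map_comm {X : Type*} [NormedAddCommGroup X] [InnerProductSpace ℝ X]
    [CompleteSpace X] {F : X →L[ℝ] X} (hF : IsSelfAdjoint F) (u v : X) :
    ⟪u, F v⟫ = ⟪v, F u⟫ := by
  rw [real_inner_comm]
  exact hF.isSymmetric v u

/-- Explicit quadratic form of the semiconvex dual kernel:
with `B11 = −M − M(P−M)⁻¹M`, `B12 = −Q'(P−M)⁻¹M`, `B22 = −Q'(P−M)⁻¹Q + R`,
the functional `x ↦ ψ(x,y) − ½⟨x,Px⟩ − ⟨x,Qz⟩ − ½⟨z,Rz⟩` attains a finite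
supremum at `x* = −(P−M)⁻¹(My + Qz)`, whose negative is
`½⟨y,B11 y⟩ + ⟨z,B12 y⟩ + ½⟨z,B22 z⟩`. -/
theorem dual_kernel_explicit {X : Type*}
    [NormedAddCommGroup X] [InnerProductSpace ℝ X] [CompleteSpace X]
    (M P R Q : X →L[ℝ] X)
    (hM : IsSelfAdjoint M) (hP : IsSelfAdjoint P) (hR : IsSelfAdjoint R)
    (hcoer : Coercive (P - M)) :
    IsSelfAdjoint (-M - M ∘L Ring.inverse (P - M) ∘L M) ∧
    IsSelfAdjoint (-(ContinuousLinearMap.adjoint Q ∘L Ring.inverse (P - M) ∘L Q) + R) ∧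
    ∀ y z : X,
      IsGreatest
        (Set.range fun x : X =>
          1/2 * ⟪x - y, M (x - y)⟫ - 1/2 * ⟪x, P x⟫ - ⟪x, Q z⟫ - 1/2 * ⟪z, R z⟫)
        (let xs := -(Ring.inverse (P - M) (M y + Q z));
          1/2 * ⟪xs - y, M (xs - y)⟫ - 1/2 * ⟪xs, P xs⟫ - ⟪xs, Q z⟫ - 1/2 * ⟪z, R z⟫) ∧
      -(let xs := -(Ring.inverse (P - M) (M y + Q z));
          1/2 * ⟪xs - y, M (xs - y)⟫ - 1/2 * ⟪xs, P xs⟫ - ⟪xs, Q z⟫ - 1/2 * ⟪z, R z⟫) =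
        1/2 * ⟪y, (-M - M ∘L Ring.inverse (P - M) ∘L M) y⟫ +
        ⟪z, (-(ContinuousLinearMap.adjoint Q ∘L Ring.inverse (P - M) ∘L M)) y⟫ +
        1/2 * ⟪z, ((-(ContinuousLinearMap.adjoint Q ∘L Ring.inverse (P - M) ∘L Q) + R)) z⟫ := by
  have hG : IsSelfAdjoint (Ring.inverse (P - M)) := (hP.sub hM).ringInverse
  have hinv (w : X) : P (Ring.inverse (P - M) w) = M (Ring.inverse (P - M) w) + w := by
    have h := DFunLike.congr_fun (Ring.mul_inverse_cancel (P - M) hcoer.isUnit) w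
    simp only [mul_apply_eq_comp, sub_apply, one_apply_eq_self] at h
    rw [← sub_eq_iff_eq_add']
    exact h
  obtain ⟨ε, hε, hpos⟩ := hcoer
  generalize Ring.inverse (P - M) = G at *
  refine ⟨?_, ?_, fun y z => ⟨⟨Set.mem_range_self _, ?_⟩, ?_⟩⟩
  · have h := hG.adjoint_conj M
    rw [hM.adjoint_eq] at h
    exact hM.neg.sub h
  · exact (hG.adjoint_conj Q).neg.add hR
  · rintro _ ⟨x, rfl⟩
    set w := M y + Q z with hw
    have h := (by positivity : 0 ≤ ε * ‖x + G w‖ ^ 2).trans (hpos (x + G w))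
    have hQ : Q z = w - M y := by rw [hw]; abel
    simp only [hQ, sub_apply, map_add, map_sub, map_neg, hinv,
      inner_add_left, inner_add_right, inner_sub_left, inner_sub_right, inner_neg_left,
      inner_neg_right] at h ⊢
    have h1 := hM.inner_map_comm x y
    have h2 := hM.inner_map_comm (G w) y
    have h3 := hM.inner_map_comm x (G w)
    have h4 := hP.inner_map_comm x (G w)
    simp only [hinv, inner_add_right] at h4
    linarith
  · have h1 := hM.inner_map_comm y (G (M y))
    have h2 := hM.inner_map_comm y (G (Q z))
    have h3 := hG.inner_map_comm (Q z) (M y)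
    have h4 := real_inner_comm (G (M y)) (Q z)
    have h5 := real_inner_comm (G (Q z)) (M y)
    have h6 := real_inner_comm (G (Q z)) (Q z)
    simp only [sub_apply, add_apply,
      neg_apply, ContinuousLinearMap.comp_apply, map_add, map_sub, map_neg,
      hinv, inner_add_left, inner_add_right, inner_sub_left, inner_sub_right, inner_neg_left,
      inner_neg_right, ContinuousLinearMap.adjoint_inner_right]
    linarith
end

section
/- Let X be a real Hilbert space, M ∈ Σ(X), and M̃ ∈ Σ(X) with M̃ − M coercive (hence boundedly invertible). Define Ñ = M + M (M̃ − M)⁻¹ M. Then: (i) Ñ = M (M̃ − M)⁻¹ M̃; (ii) for every z ∈ X, − sup_{x ∈ X} [ ½⟨x − z, M(x − z)⟩ − ½⟨x, M̃ x⟩ ] = −½⟨z, Ñ z⟩, the supremum being finite and attained at x* = −(M̃ − M)⁻¹ M z; and (iii) for every K ∈ Σ(X) with ⟨z, (K + M) z⟩ ≥ 0 for all z, the function z ↦ −½⟨z, Ñ z⟩ − ½⟨z, K z⟩ is concave on X. -/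
open RealInnerProductSpace

/-- The quadratic form of a bounded operator is convex if it is nonnegative. -/
theorem convexOn_inner_map_self {X : Type*} [NormedAddCommGroup X] [InnerProductSpace ℝ X]
    {F : X →L[ℝ] X} (hF : ∀ z : X, 0 ≤ ⟪z, F z⟫) :
    ConvexOn ℝ Set.univ fun z : X => ⟪z, F z⟫ := by
  refine ⟨convex_univ, fun x _ y _ a b ha hb hab => ?_⟩
  have h := mul_nonneg (mul_nonneg ha hb) (hF (x - y))
  obtain rfl : b = 1 - a := by linarith
  simp only [map_sub, map_add, map_smul, inner_sub_left, inner_sub_right, inner_add_left,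
    inner_add_right, real_inner_smul_left, real_inner_smul_right, smul_eq_mul] at h ⊢
  linarith

/-- The semiconvex dual of the quadratic terminal payoff
`x ↦ ½⟨x, M̃ x⟩`: with `Ñ = M + M(M̃−M)⁻¹M`, one has (i) `Ñ = M(M̃−M)⁻¹M̃`;
(ii) `− sup_x (ψ(x,z) − ½⟨x, M̃ x⟩) = −½⟨z, Ñ z⟩` with the supremum attained
at `x* = −(M̃−M)⁻¹ M z` (note the sign convention of the paper); and
(iii) for `K` with `K + M ≥ 0`, `z ↦ −½⟨z,Ñz⟩ − ½⟨z,Kz⟩` is concave. -/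
theorem terminal_payoff_dual {X : Type*}
    [NormedAddCommGroup X] [InnerProductSpace ℝ X] [CompleteSpace X]
    (M Mt : X →L[ℝ] X) (hM : IsSelfAdjoint M) (hMt : IsSelfAdjoint Mt)
    (hcoer : Coercive (Mt - M)) :
    (M + M ∘L Ring.inverse (Mt - M) ∘L M = M ∘L Ring.inverse (Mt - M) ∘L Mt) ∧
    (∀ z : X,
      IsGreatest
        (Set.range fun x : X =>
          1/2 * ⟪x - z, M (x - z)⟫ - 1/2 * ⟪x, Mt x⟫)
        (let xs := -(Ring.inverse (Mt - M) (M z));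
          1/2 * ⟪xs - z, M (xs - z)⟫ - 1/2 * ⟪xs, Mt xs⟫) ∧
      -(let xs := -(Ring.inverse (Mt - M) (M z));
          1/2 * ⟪xs - z, M (xs - z)⟫ - 1/2 * ⟪xs, Mt xs⟫) =
        -(1/2 * ⟪z, (M + M ∘L Ring.inverse (Mt - M) ∘L M) z⟫)) ∧
    ∀ K : X →L[ℝ] X, IsSelfAdjoint K → (∀ z : X, 0 ≤ ⟪z, (K + M) z⟫) →
      ConcaveOn ℝ Set.univ (fun z : X =>
        -(1/2 * ⟪z, (M + M ∘L Ring.inverse (Mt - M) ∘L M) z⟫) - 1/2 * ⟪z, K z⟫) := by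
  obtain ⟨ε, hε, hpos⟩ := hcoer
  have hu : IsUnit (Mt - M) := Coercive.isUnit ⟨ε, hε, hpos⟩
  have hnonneg (x : X) : 0 ≤ ⟪x, (Mt - M) x⟫ := le_trans (by positivity) (hpos x)
  have hsymM (x y : X) : ⟪M x, y⟫ = ⟪x, M y⟫ := hM.isSymmetric x y
  have hsymMt (x y : X) : ⟪Mt x, y⟫ = ⟪x, Mt y⟫ := hMt.isSymmetric x y
  set R := Ring.inverse (Mt - M)
  have hleft : R ∘L (Mt - M) = 1 := Ring.inverse_mul_cancel _ hu
  have hright (x : X) : Mt (R x) = x + M (R x) := by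
    have h := DFunLike.congr_fun (Ring.mul_inverse_cancel _ hu) x
    exact sub_eq_iff_eq_add.mp h
  refine ⟨?_, fun z => ?_, fun K _ hKM => ?_⟩
  · have h : R ∘L Mt = 1 + R ∘L M := by
      rw [← hleft, ← ContinuousLinearMap.comp_add, sub_add_cancel]
    rw [h, ContinuousLinearMap.comp_add]
    rfl
  · have hquad (x : X) : 1/2 * ⟪x - z, M (x - z)⟫ - 1/2 * ⟪x, Mt x⟫ =
        1/2 * ⟪z, (M + M ∘L R ∘L M) z⟫
          - 1/2 * ⟪x + R (M z), (Mt - M) (x + R (M z))⟫ := by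
      have h₁ := hsymM x z
      have h₂ := hsymM z (R (M z))
      have h₃ := hsymMt (R (M z)) x
      have h₄ := hsymM (R (M z)) x
      rw [hright, inner_add_left] at h₃
      simp only [add_apply, sub_apply,
        ContinuousLinearMap.comp_apply, map_sub, map_add, hright,
        inner_sub_left, inner_sub_right, inner_add_left, inner_add_right] at *
      linarith [real_inner_comm x (M z), real_inner_comm z (M x), real_inner_comm (R (M z)) (M z)]
    have hval := hquad (-(R (M z)))
    rw [neg_add_cancel, inner_zero_left, mul_zero, sub_zero] at hval
    refine ⟨⟨⟨_, rfl⟩, ?_⟩, congrArg Neg.neg hval⟩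
    rintro _ ⟨x, rfl⟩
    refine le_of_le_of_eq ?_ hval.symm
    linarith [hquad x, hnonneg (x + R (M z))]
  · have hform (z : X) : 0 ≤ ⟪z, (M + M ∘L R ∘L M + K) z⟫ := by
      have h₁ := hnonneg (R (M z))
      have h₂ := hKM z
      have h₃ := hsymM z (R (M z))
      simp only [add_apply, sub_apply,
        ContinuousLinearMap.comp_apply, hright,
        inner_sub_right, inner_add_right] at *
      linarith [real_inner_comm (R (M z)) (M z)]
    have h := ((convexOn_inner_map_self hform).smul (c := (1/2 : ℝ)) (by norm_num)).neg
    refine h.congr fun z _ => ?_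
    simp only [Pi.neg_apply, smul_eq_mul, add_apply, inner_add_right]
    ring
end

section
/- Let X be a real Hilbert space, A11, A22, C11, C22 ∈ Σ(X) and A12, C12 ∈ B(X). Define the quadratic kernels K_A(y,ξ) = ½⟨y, A11 y⟩ + ⟨ξ, A12 y⟩ + ½⟨ξ, A22 ξ⟩ and K_C(ξ,z) = ½⟨ξ, C11 ξ⟩ + ⟨z, C12 ξ⟩ + ½⟨z, C22 z⟩, and set S = A22 + C11. Suppose ⟨ξ, S ξ⟩ ≤ 0 for all ξ ∈ X, suppose G ∈ Σ(X) satisfies the Moore–Penrose identities S G S = S and G S G = G with S G self-adjoint, and let y, z ∈ X be such that A12 y + C12' z lies in the range of S. Then sup_{ξ ∈ X} ( K_A(y,ξ) + K_C(ξ,z) ) is finite and equals ½⟨y, (A11 − A12' G A12) y⟩ + ⟨z, (−C12 G A12) y⟩ + ½⟨z, (C22 − C12 G C12') z⟩, the supremum being attained at ξ* = −G (A12 y + C12' z). -/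
open RealInnerProductSpace

/-- Completing the square for a symmetric operator `S` at a solution `u` of `S u = b`. -/
theorem inner_add_half_inner_apply_eq {X : Type*} [NormedAddCommGroup X] [InnerProductSpace ℝ X]
    {S : X →L[ℝ] X} (hS : (S : X →ₗ[ℝ] X).IsSymmetric) {u b : X} (hu : S u = b) (ξ : X) :
    ⟪ξ, b⟫ + 1/2 * ⟪ξ, S ξ⟫ = 1/2 * ⟪ξ + u, S (ξ + u)⟫ - 1/2 * ⟪b, u⟫ := by
  have h : ⟪u, S ξ⟫ = ⟪ξ, b⟫ := by
    rw [← hu, real_inner_comm]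
    exact hS ξ u
  simp only [map_add, inner_add_left, inner_add_right, hu, h, real_inner_comm u b]
  ring

/-- Expansion of the quadratic form of a self-adjoint `G` at `A y + adjoint C z`. -/
theorem IsSelfAdjoint.inner_apply_add_adjoint_apply {X : Type*} [NormedAddCommGroup X]
    [InnerProductSpace ℝ X] [CompleteSpace X] {G : X →L[ℝ] X} (hG : IsSelfAdjoint G)
    (A C : X →L[ℝ] X) (y z : X) :
    ⟪A y + ContinuousLinearMap.adjoint C z, G (A y + ContinuousLinearMap.adjoint C z)⟫ =
      ⟪y, ContinuousLinearMap.adjoint A (G (A y))⟫ + 2 * ⟪z, C (G (A y))⟫ +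
        ⟪z, C (G (ContinuousLinearMap.adjoint C z))⟫ := by
  have h : ⟪A y, G (ContinuousLinearMap.adjoint C z)⟫ = ⟪z, C (G (A y))⟫ := by
    rw [← real_inner_comm z, ← ContinuousLinearMap.adjoint_inner_right C]
    exact (hG.isSymmetric (A y) _).symm
  simp only [map_add, inner_add_left, inner_add_right, h,
    ContinuousLinearMap.adjoint_inner_left, ContinuousLinearMap.adjoint_inner_right]
  ring

/-- The max-plus composition of two quadratic kernels:
with `S = A22 + C11 ≤ 0`, `G` a Moore–Penrose pseudo-inverse of `S`, and
`A12 y + C12' z` in the range of `S`, the supremum over `ξ` of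
`K_A(y,ξ) + K_C(ξ,z)` is finite, attained at `ξ* = −G(A12 y + C12' z)`, and
given by the composed quadratic kernel. -/
theorem maxplus_kernel_composition {X : Type*}
    [NormedAddCommGroup X] [InnerProductSpace ℝ X] [CompleteSpace X]
    (A11 A22 C11 C22 A12 C12 G : X →L[ℝ] X)
    (hA11 : IsSelfAdjoint A11) (hA22 : IsSelfAdjoint A22)
    (hC11 : IsSelfAdjoint C11) (hC22 : IsSelfAdjoint C22)
    (hSnonpos : ∀ ξ : X, ⟪ξ, (A22 + C11) ξ⟫ ≤ 0)
    (hG : IsSelfAdjoint G)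
    (hSGS : (A22 + C11) ∘L G ∘L (A22 + C11) = A22 + C11)
    (hGSG : G ∘L (A22 + C11) ∘L G = G)
    (hSGsa : IsSelfAdjoint ((A22 + C11) ∘L G))
    (y z : X)
    (hrange : A12 y + ContinuousLinearMap.adjoint C12 z ∈ Set.range (A22 + C11)) :
    IsGreatest
      (Set.range fun ξ : X =>
        (1/2 * ⟪y, A11 y⟫ + ⟪ξ, A12 y⟫ + 1/2 * ⟪ξ, A22 ξ⟫) +
        (1/2 * ⟪ξ, C11 ξ⟫ + ⟪z, C12 ξ⟫ + 1/2 * ⟪z, C22 z⟫))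
      (1/2 * ⟪y, (A11 - ContinuousLinearMap.adjoint A12 ∘L G ∘L A12) y⟫ +
        ⟪z, (-(C12 ∘L G ∘L A12)) y⟫ +
        1/2 * ⟪z, (C22 - C12 ∘L G ∘L ContinuousLinearMap.adjoint C12) z⟫) ∧
    (let ξs := -(G (A12 y + ContinuousLinearMap.adjoint C12 z));
      (1/2 * ⟪y, A11 y⟫ + ⟪ξs, A12 y⟫ + 1/2 * ⟪ξs, A22 ξs⟫) +
        (1/2 * ⟪ξs, C11 ξs⟫ + ⟪z, C12 ξs⟫ + 1/2 * ⟪z, C22 z⟫)) =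
      1/2 * ⟪y, (A11 - ContinuousLinearMap.adjoint A12 ∘L G ∘L A12) y⟫ +
        ⟪z, (-(C12 ∘L G ∘L A12)) y⟫ +
        1/2 * ⟪z, (C22 - C12 ∘L G ∘L ContinuousLinearMap.adjoint C12) z⟫ := by
  have hSG : (A22 + C11) (G (A12 y + ContinuousLinearMap.adjoint C12 z)) =
      A12 y + ContinuousLinearMap.adjoint C12 z := by
    obtain ⟨w, hw⟩ := hrange
    rw [← hw]
    exact congrArg (fun T : X →L[ℝ] X => T w) hSGS
  have key : ∀ ξ : X,
      (1/2 * ⟪y, A11 y⟫ + ⟪ξ, A12 y⟫ + 1/2 * ⟪ξ, A22 ξ⟫) +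
        (1/2 * ⟪ξ, C11 ξ⟫ + ⟪z, C12 ξ⟫ + 1/2 * ⟪z, C22 z⟫) =
      (1/2 * ⟪y, (A11 - ContinuousLinearMap.adjoint A12 ∘L G ∘L A12) y⟫ +
        ⟪z, (-(C12 ∘L G ∘L A12)) y⟫ +
        1/2 * ⟪z, (C22 - C12 ∘L G ∘L ContinuousLinearMap.adjoint C12) z⟫) +
      1/2 * ⟪ξ + G (A12 y + ContinuousLinearMap.adjoint C12 z),
        (A22 + C11) (ξ + G (A12 y + ContinuousLinearMap.adjoint C12 z))⟫ := by
    intro ξ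
    have hsq := inner_add_half_inner_apply_eq (hA22.add hC11).isSymmetric hSG ξ
    have hexp := hG.inner_apply_add_adjoint_apply A12 C12 y z
    have hC : ⟪ξ, ContinuousLinearMap.adjoint C12 z⟫ = ⟪z, C12 ξ⟫ := by
      rw [ContinuousLinearMap.adjoint_inner_right, real_inner_comm]
    have hlin : ⟪ξ, A12 y + ContinuousLinearMap.adjoint C12 z⟫ = ⟪ξ, A12 y⟫ + ⟪z, C12 ξ⟫ := by
      rw [inner_add_right, hC]
    have hquad : ⟪ξ, (A22 + C11) ξ⟫ = ⟪ξ, A22 ξ⟫ + ⟪ξ, C11 ξ⟫ := by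
      rw [add_apply, inner_add_right]
    rw [hlin, hquad] at hsq
    simp only [sub_apply, neg_apply,
      ContinuousLinearMap.comp_apply, inner_sub_right, inner_neg_right]
    linarith
  have hmax := key (-(G (A12 y + ContinuousLinearMap.adjoint C12 z)))
  rw [neg_add_cancel, map_zero, inner_zero_right, mul_zero, add_zero] at hmax
  refine ⟨⟨⟨_, hmax⟩, ?_⟩, hmax⟩
  rintro _ ⟨ξ, rfl⟩
  have := hSnonpos (ξ + G (A12 y + ContinuousLinearMap.adjoint C12 z))
  linarith [key ξ]
end

section
/- Let X be a real Banach space and A : D → X a linear map defined on a dense subspace D ⊆ X. Let M ≥ 1, ω₀ ≥ 0 and n₀ ∈ ℕ with n₀ > ω₀, and suppose that for every natural number n ≥ n₀ the map x ↦ n x − A x is a bijection from D onto X whose inverse R(n) is a bounded linear operator on X with ‖R(n)‖ ≤ M/(n − ω₀). Then for every n ≥ n₀: (i) R(n)x ∈ D for all x ∈ X, and the operator A_n := n(n R(n) − I) is a bounded linear operator on X satisfying A_n x = n A(R(n) x) for all x ∈ X; and (ii) for every x ∈ D, A_n x → A x in X as n → ∞. -/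
open Filter Topology

/-- A uniformly bounded sequence of operators which converges strongly to the identity on a dense
set converges strongly to the identity everywhere. -/
theorem tendsto_apply_self_of_dense {X : Type*} [NormedAddCommGroup X] [NormedSpace ℝ X]
    {s : Set X} (hs : Dense s) {T : ℕ → X →L[ℝ] X} {C : ℝ} (hC : ∀ᶠ n in atTop, ‖T n‖ ≤ C)
    (hT : ∀ y ∈ s, Tendsto (fun n => T n y) atTop (𝓝 y)) (x : X) :
    Tendsto (fun n => T n x) atTop (𝓝 x) := by
  have hC0 : 0 ≤ C := by
    obtain ⟨n, hn⟩ := hC.exists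
    exact (norm_nonneg _).trans hn
  rw [Metric.tendsto_nhds]
  intro ε hε
  have hδ : 0 < ε / (2 * (C + 1)) := by positivity
  obtain ⟨y, hy, hxy⟩ := hs.exists_dist_lt x hδ
  filter_upwards [hC, Metric.tendsto_nhds.1 (hT y hy) (ε / 2) (by positivity)] with n hn hny
  have hTxy : dist (T n x) (T n y) ≤ C * dist x y := by
    rw [dist_eq_norm, dist_eq_norm, ← map_sub]
    exact (T n).le_of_opNorm_le hn _
  have hsmall : (C + 1) * dist x y < ε / 2 := by
    rw [lt_div_iff₀ (by positivity)] at hxy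
    linarith
  have h₁ := dist_triangle (T n x) (T n y) x
  have h₂ := dist_triangle (T n y) y x
  rw [dist_comm y x] at h₂
  linarith

/-- Yosida approximation: if `A` is densely defined and for
`n ≥ n₀ > ω₀` the map `x ↦ n x − A x` is a bijection of `D` onto `X` with
bounded inverse `R(n)` satisfying `‖R(n)‖ ≤ M/(n − ω₀)`, then `R(n)` maps `X`
into `D`, the Yosida approximation `A_n = n(n R(n) − I)` is a bounded operator
with `A_n x = n A (R(n) x)`, and `A_n x → A x` for every `x ∈ D`. -/
theorem yosida_approximation {X : Type*}
    [NormedAddCommGroup X] [NormedSpace ℝ X] [CompleteSpace X]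
    (D : Submodule ℝ X) (hD : Dense (D : Set X)) (A : D →ₗ[ℝ] X)
    (M ω₀ : ℝ) (hM : 1 ≤ M) (hω₀ : 0 ≤ ω₀) (n₀ : ℕ) (hn₀ : ω₀ < (n₀ : ℝ))
    (R : ℕ → X →L[ℝ] X)
    (hbij : ∀ n : ℕ, n₀ ≤ n → Function.Bijective (fun d : D => (n : ℝ) • (d : X) - A d))
    (hinv : ∀ n : ℕ, n₀ ≤ n → ∀ d : D, R n ((n : ℝ) • (d : X) - A d) = (d : X))
    (hnorm : ∀ n : ℕ, n₀ ≤ n → ‖R n‖ ≤ M / ((n : ℝ) - ω₀)) :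
    (∀ n : ℕ, n₀ ≤ n → ∀ x : X, R n x ∈ D) ∧
    (∀ n : ℕ, n₀ ≤ n → ∀ x : X, ∀ h : R n x ∈ D,
      ((n : ℝ) • ((n : ℝ) • R n - 1)) x = (n : ℝ) • A ⟨R n x, h⟩) ∧
    ∀ d : D, Filter.Tendsto (fun n : ℕ => ((n : ℝ) • ((n : ℝ) • R n - 1)) (d : X))
      Filter.atTop (nhds (A d)) := by
  have hmem : ∀ n : ℕ, n₀ ≤ n → ∀ x : X, R n x ∈ D := by
    intro n hn x
    obtain ⟨d, rfl⟩ := (hbij n hn).2 x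
    simp only [hinv n hn d, d.2]
  have hcomm : ∀ n : ℕ, n₀ ≤ n → ∀ d : D, (n : ℝ) • R n (d : X) - d = R n (A d) := by
    intro n hn d
    have h := hinv n hn d
    rw [map_sub, map_smul] at h
    rw [sub_eq_iff_eq_add, ← sub_eq_iff_eq_add']
    exact h
  refine ⟨hmem, ?_, ?_⟩
  · intro n hn x h
    obtain ⟨d, rfl⟩ := (hbij n hn).2 x
    have hd : (⟨_, h⟩ : D) = d := Subtype.ext (hinv n hn d)
    rw [hd]
    simp [hinv n hn d]
  · have hR : ∀ y : X, Tendsto (fun n => R n y) atTop (𝓝 0) := by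
      intro y
      have hlim : Tendsto (fun n : ℕ => M / ((n : ℝ) - ω₀) * ‖y‖) atTop (𝓝 0) := by
        have h : Tendsto (fun n : ℕ => (n : ℝ) - ω₀) atTop atTop :=
          tendsto_atTop_add_const_right _ _ tendsto_natCast_atTop_atTop
        simpa using (h.const_div_atTop M).mul_const ‖y‖
      refine squeeze_zero_norm' ?_ hlim
      filter_upwards [eventually_ge_atTop n₀] with n hn
      exact (R n).le_of_opNorm_le (hnorm n hn) y
    have hbound : ∀ᶠ n : ℕ in atTop, ‖(n : ℝ) • R n‖ ≤ M * n₀ / (n₀ - ω₀) := by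
      filter_upwards [eventually_ge_atTop n₀] with n hn
      have hn' : (n₀ : ℝ) ≤ n := by exact_mod_cast hn
      rw [norm_smul, Real.norm_natCast]
      refine (mul_le_mul_of_nonneg_left (hnorm n hn) n.cast_nonneg).trans ?_
      rw [← mul_div_assoc, div_le_div_iff₀ (by linarith) (by linarith)]
      nlinarith [mul_nonneg (mul_nonneg (zero_le_one.trans hM) hω₀) (sub_nonneg.2 hn')]
    have hid := tendsto_apply_self_of_dense (T := fun n : ℕ => (n : ℝ) • R n) hD hbound (by
      intro y hy
      rw [← tendsto_sub_nhds_zero_iff]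
      refine (hR (A ⟨y, hy⟩)).congr' ?_
      filter_upwards [eventually_ge_atTop n₀] with n hn
      exact (hcomm n hn ⟨y, hy⟩).symm)
    intro d
    refine (hid (A d)).congr' ?_
    filter_upwards [eventually_ge_atTop n₀] with n hn
    simp [← hcomm n hn d]
end

section
/- Let M be a monoid with identity 1, let τ > 0, and let F : [0,τ] → M satisfy F(0) = 1 and F(s + t) = F(s) · F(t) = F(t) · F(s) for all s, t ∈ [0,τ] with s + t ∈ [0,τ]. On the set Γ_τ(F) = { (t, F(t)) : t ∈ [0,τ] } define the binary operation (s, F(s)) ∘ (t, F(t)) = (s + t, F(s)·F(t)) if s + t < τ, and = (τ, F(τ)) if s + t ≥ τ. Then ∘ is well defined on Γ_τ(F), is associative, and (0, F(0)) is a two-sided identity; that is, (Γ_τ(F), ∘) is a monoid. -/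
/-- The set of horizon–operator pairs `Γ_τ(F) = {(t, F t) : t ∈ [0,τ]}`. -/
def horizonGraph {M : Type*} (τ : ℝ) (F : ℝ → M) : Set (ℝ × M) :=
  {p | p.1 ∈ Set.Icc 0 τ ∧ p.2 = F p.1}

/-- The horizon-truncated product on pairs:
`(s, a) ∘ (t, b) = (s + t, a * b)` if `s + t < τ`, and `(τ, F τ)` otherwise. -/
noncomputable def horizonMul {M : Type*} [Mul M] (τ : ℝ) (F : ℝ → M)
    (p q : ℝ × M) : ℝ × M :=
  if p.1 + q.1 < τ then (p.1 + q.1, p.2 * q.2) else (τ, F τ)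

theorem mem_horizonGraph_iff {M : Type*} {τ : ℝ} {F : ℝ → M} {p : ℝ × M} :
    p ∈ horizonGraph τ F ↔ ∃ t ∈ Set.Icc 0 τ, (t, F t) = p :=
  ⟨fun h => ⟨p.1, h.1, Prod.ext rfl h.2.symm⟩, fun ⟨_, ht, h⟩ => h ▸ ⟨ht, rfl⟩⟩

theorem horizonMul_graph {M : Type*} [Mul M] {τ : ℝ} {F : ℝ → M}
    (hsemi : ∀ s t : ℝ, s ∈ Set.Icc 0 τ → t ∈ Set.Icc 0 τ → s + t ∈ Set.Icc 0 τ →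
      F (s + t) = F s * F t)
    {s t : ℝ} (hs : s ∈ Set.Icc 0 τ) (ht : t ∈ Set.Icc 0 τ) :
    horizonMul τ F (s, F s) (t, F t) = (min (s + t) τ, F (min (s + t) τ)) := by
  unfold horizonMul
  split_ifs with h
  · rw [min_eq_left h.le, hsemi s t hs ht ⟨add_nonneg hs.1 ht.1, h.le⟩]
  · rw [min_eq_right (not_lt.mp h)]

theorem min_add_mem_Icc {τ s t : ℝ} (hs : s ∈ Set.Icc 0 τ) (ht : t ∈ Set.Icc 0 τ) :
    min (s + t) τ ∈ Set.Icc 0 τ :=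
  ⟨le_min (add_nonneg hs.1 ht.1) (hs.1.trans hs.2), min_le_right _ _⟩

theorem min_add_min_add {τ s t r : ℝ} (hs : 0 ≤ s) (hr : 0 ≤ r) :
    min (min (s + t) τ + r) τ = min (s + min (t + r) τ) τ := by
  grind

/-- The horizon-truncated semigroup construction: for a
commuting one-parameter family `F` on `[0,τ]` with `F 0 = 1` and the semigroup
property, the truncated product is well defined on `Γ_τ(F)`, associative, and
has `(0, F 0)` as a two-sided identity, so `(Γ_τ(F), ∘)` is a monoid. -/
theorem horizon_truncated_monoid {M : Type*} [Monoid M] (τ : ℝ) (hτ : 0 < τ)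
    (F : ℝ → M) (hF0 : F 0 = 1)
    (hsemi : ∀ s t : ℝ, s ∈ Set.Icc 0 τ → t ∈ Set.Icc 0 τ → s + t ∈ Set.Icc 0 τ →
      F (s + t) = F s * F t)
    (hcomm : ∀ s t : ℝ, s ∈ Set.Icc 0 τ → t ∈ Set.Icc 0 τ → F s * F t = F t * F s) :
    (∀ p ∈ horizonGraph τ F, ∀ q ∈ horizonGraph τ F,
      horizonMul τ F p q ∈ horizonGraph τ F) ∧
    (∀ p ∈ horizonGraph τ F, ∀ q ∈ horizonGraph τ F, ∀ r ∈ horizonGraph τ F,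
      horizonMul τ F (horizonMul τ F p q) r = horizonMul τ F p (horizonMul τ F q r)) ∧
    (∀ p ∈ horizonGraph τ F,
      horizonMul τ F (0, F 0) p = p ∧ horizonMul τ F p (0, F 0) = p) := by
  refine ⟨?_, ?_, ?_⟩
  · intro _ hp _ hq
    obtain ⟨s, hs, rfl⟩ := mem_horizonGraph_iff.mp hp
    obtain ⟨t, ht, rfl⟩ := mem_horizonGraph_iff.mp hq
    rw [horizonMul_graph hsemi hs ht]
    exact ⟨min_add_mem_Icc hs ht, rfl⟩
  · intro _ hp _ hq _ hr'
    obtain ⟨s, hs, rfl⟩ := mem_horizonGraph_iff.mp hp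
    obtain ⟨t, ht, rfl⟩ := mem_horizonGraph_iff.mp hq
    obtain ⟨r, hr, rfl⟩ := mem_horizonGraph_iff.mp hr'
    rw [horizonMul_graph hsemi hs ht, horizonMul_graph hsemi ht hr,
      horizonMul_graph hsemi (min_add_mem_Icc hs ht) hr,
      horizonMul_graph hsemi hs (min_add_mem_Icc ht hr), min_add_min_add hs.1 hr.1]
  · intro _ hq
    obtain ⟨t, ht, rfl⟩ := mem_horizonGraph_iff.mp hq
    have h0 : (0 : ℝ) ∈ Set.Icc 0 τ := ⟨le_rfl, hτ.le⟩
    rw [horizonMul_graph hsemi h0 ht, horizonMul_graph hsemi ht h0, zero_add, add_zero,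
      min_eq_left ht.2]
    exact ⟨rfl, rfl⟩
end
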